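/- Let j be an integer, ell >= 0 an integer, and q complex with |q| < 1. Then sum over integers m >= 0 with m == j (mod 2), and over partitions lambda of (j+m)/2 (this set is empty when (j+m)/2 < 0), of q^{C(m+1,2) - m*lambda_1 + 2 n(lambda') + |lambda| - (lambda_1 + ... + lambda_ell)} / ((q;q)_m b_{lambda'}(q)) equals (q;q)_inf^{-1} sum_{i >= 0} ( q^{C(j-2i,2)} - q^{C(j-2i-2ell-1,2)} ) / (q;q)_i. Here lambda_1 + ... + lambda_ell denotes the sum of the first ell entries of lambda (with trailing zeros). -/

import Mathlib

open scoped BigOperators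

noncomputable section

/-- Finite q-Pochhammer symbol `(a;q)_n`. -/
def qP (q a : ℂ) (n : ℕ) : ℂ := ∏ m ∈ Finset.range n, (1 - a * q ^ m)

/-- Infinite q-Pochhammer symbol `(a;q)_∞`. -/
def qPInf (q a : ℂ) : ℂ := ∏' m : ℕ, (1 - a * q ^ m)

/-- `C(n,2) = n(n-1)/2` for `n : ℤ` (exact integer division). -/
def ch2 (n : ℤ) : ℤ := n * (n - 1) / 2

/-- A partition: a weakly decreasing, finitely supported sequence of
nonnegative integers; `p i` is the part `λ_{i+1}` (0-indexed). -/
structure Ptn where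
  p : ℕ →₀ ℕ
  mono : ∀ ⦃i j : ℕ⦄, i ≤ j → p j ≤ p i

namespace Ptn

/-- The weight `|λ|`. -/
def wt (P : Ptn) : ℕ := P.p.sum fun _ v => v

/-- The entry `λ'_j` of the conjugate partition (here `j ≥ 1`). -/
def conj (P : Ptn) (j : ℕ) : ℕ := (P.p.support.filter fun i => j ≤ P.p i).card

/-- `n(λ') = Σ_{i≥1} (i-1) λ'_i`. -/
def nConj (P : Ptn) : ℕ := ∑ i ∈ Finset.range (P.p 0), i * P.conj (i + 1)

/-- `b_{λ'}(q) = Π_{i≥1} (q;q)_{m_i(λ')}`, using `m_i(λ') = λ_i - λ_{i+1}`. -/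
def bConj (q : ℂ) (P : Ptn) : ℂ := ∏ i ∈ P.p.support, qP q q (P.p i - P.p (i + 1))

/-- The sum of the first `ℓ` entries `λ_1 + ⋯ + λ_ℓ`. -/
def headSum (P : Ptn) (ℓ : ℕ) : ℕ := ∑ i ∈ Finset.range ℓ, P.p i

end Ptn

section Helpers

open Filter Topology Finset

theorem ch2_two (n : ℤ) : 2 * ch2 n = n * (n - 1) := by
  unfold ch2
  have h : (2 : ℤ) ∣ n * (n - 1) := by
    have := Int.even_mul_pred_self n
    exact this.two_dvd
  omega

theorem ch2_nonneg (n : ℤ) : 0 ≤ ch2 n := by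
  have h := ch2_two n
  have : 0 ≤ n * (n - 1) := by
    rcases le_or_gt n 0 with h0 | h0
    · nlinarith
    · have : 1 ≤ n := h0
      nlinarith
  linarith

/-- natural version of `ch2` -/
def c2 (n : ℤ) : ℕ := (ch2 n).toNat

theorem c2_cast (n : ℤ) : (c2 n : ℤ) = ch2 n := Int.toNat_of_nonneg (ch2_nonneg n)

theorem c2_two (n : ℤ) : 2 * (c2 n : ℤ) = n * (n - 1) := by rw [c2_cast, ch2_two]

theorem zpow_ch2 (q : ℂ) (n : ℤ) : q ^ (ch2 n) = q ^ (c2 n) := by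
  rw [← c2_cast, zpow_natCast]

theorem c2_zero : c2 0 = 0 := by decide

theorem c2_succ (n : ℕ) : c2 ((n + 1 : ℕ) : ℤ) = c2 (n : ℤ) + n := by
  have h1 := c2_two ((n + 1 : ℕ) : ℤ)
  have h2 := c2_two (n : ℤ)
  push_cast at h1
  have : (c2 ((n + 1 : ℕ) : ℤ) : ℤ) = c2 (n : ℤ) + n := by push_cast; linarith
  exact_mod_cast this

theorem qP_zero (q a : ℂ) : qP q a 0 = 1 := by simp [qP]

theorem qP_succ (q : ℂ) (n : ℕ) : qP q q (n + 1) = qP q q n * (1 - q ^ (n + 1)) := by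
  rw [qP, Finset.prod_range_succ, ← qP, pow_succ']

theorem one_sub_pow_ne {q : ℂ} (hq : ‖q‖ < 1) (n : ℕ) : 1 - q ^ (n + 1) ≠ 0 := by
  intro h
  have h1 : q ^ (n + 1) = 1 := by linear_combination -h
  have h2 : ‖q‖ ^ (n + 1) = 1 := by rw [← norm_pow, h1, norm_one]
  have h3 : ‖q‖ ^ (n + 1) < 1 := pow_lt_one₀ (norm_nonneg _) hq (by omega)
  linarith

theorem qP_ne {q : ℂ} (hq : ‖q‖ < 1) (n : ℕ) : qP q q n ≠ 0 := by
  induction n with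
  | zero => simp [qP_zero]
  | succ n ih => rw [qP_succ]; exact mul_ne_zero ih (one_sub_pow_ne hq n)

/-- `1/(q;q)_n` -/
def fq (q : ℂ) (n : ℕ) : ℂ := (qP q q n)⁻¹

theorem fq_zero (q : ℂ) : fq q 0 = 1 := by simp [fq, qP_zero]

theorem fq_succ {q : ℂ} (hq : ‖q‖ < 1) (n : ℕ) : fq q (n + 1) * (1 - q ^ (n + 1)) = fq q n := by
  rw [fq, qP_succ, fq, mul_inv, mul_assoc, inv_mul_cancel₀ (one_sub_pow_ne hq n), mul_one]

theorem summable_qpow {q : ℂ} (hq : ‖q‖ < 1) : Summable (fun m : ℕ => ‖-(q * q ^ m)‖) := by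
  have : Summable (fun m : ℕ => ‖q‖ * ‖q‖ ^ m) :=
    (summable_geometric_of_lt_one (norm_nonneg _) hq).mul_left _
  simpa [norm_mul, norm_pow] using this

theorem qPInf_ne {q : ℂ} (hq : ‖q‖ < 1) : qPInf q q ≠ 0 := by
  have := tprod_one_add_ne_zero_of_summable (f := fun m : ℕ => -(q * q ^ m)) (fun i => by
    have := one_sub_pow_ne hq i
    rw [← sub_eq_add_neg, ← pow_succ']; exact this) (summable_qpow hq)
  simpa [qPInf, sub_eq_add_neg] using this

theorem qP_tendsto {q : ℂ} (hq : ‖q‖ < 1) :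
    Tendsto (fun n => qP q q n) atTop (𝓝 (qPInf q q)) := by
  have h := multipliable_one_add_of_summable (summable_qpow hq)
  have := h.tendsto_prod_tprod_nat
  simpa [qPInf, qP, sub_eq_add_neg] using this

theorem fq_tendsto {q : ℂ} (hq : ‖q‖ < 1) :
    Tendsto (fun n => fq q n) atTop (𝓝 (qPInf q q)⁻¹) :=
  (qP_tendsto hq).inv₀ (qPInf_ne hq)

theorem bdd_of_tendsto {u : ℕ → ℂ} {a : ℂ} (h : Tendsto u atTop (𝓝 a)) :
    ∃ M : ℝ, ∀ n, ‖u n‖ ≤ M := by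
  obtain ⟨M, hM⟩ := (Metric.isBounded_range_of_tendsto u h).exists_norm_le
  exact ⟨M, fun n => hM _ ⟨n, rfl⟩⟩

theorem q_bdd {q : ℂ} (hq : ‖q‖ < 1) :
    ∃ M : ℝ, 1 ≤ M ∧ (∀ n, ‖qP q q n‖ ≤ M) ∧ (∀ n, ‖fq q n‖ ≤ M) := by
  obtain ⟨M1, h1⟩ := bdd_of_tendsto (qP_tendsto hq)
  obtain ⟨M2, h2⟩ := bdd_of_tendsto (fq_tendsto hq)
  refine ⟨max 1 (max M1 M2), le_max_left _ _, fun n => ?_, fun n => ?_⟩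
  · exact (h1 n).trans ((le_max_left _ _).trans (le_max_right _ _))
  · exact (h2 n).trans ((le_max_right _ _).trans (le_max_right _ _))

/-- Gaussian binomial -/
def gb (q : ℂ) (N n : ℕ) : ℂ := if n ≤ N then qP q q N * fq q n * fq q (N - n) else 0

theorem gb_zero {q : ℂ} (hq : ‖q‖ < 1) (N : ℕ) : gb q N 0 = 1 := by
  simp [gb, fq, qP_zero, mul_inv_cancel₀ (qP_ne hq N)]

theorem gb_of_lt {q : ℂ} {N n : ℕ} (h : N < n) : gb q N n = 0 := by
  simp [gb, h]

theorem gb_pascal {q : ℂ} (hq : ‖q‖ < 1) {N n : ℕ} (h : n ≤ N) :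
    gb q (N + 1) (n + 1) = gb q N (n + 1) + q ^ (N - n) * gb q N n := by
  obtain ⟨d, rfl⟩ := Nat.exists_eq_add_of_le h
  rcases d with _ | d
  · simp [gb, fq, qP_zero, qP_ne hq]
  · have e1 : n + (d + 1) + 1 - (n + 1) = d + 1 := by omega
    have e2 : n + (d + 1) - (n + 1) = d := by omega
    have e3 : n + (d + 1) - n = d + 1 := by omega
    have l1 : n + 1 ≤ n + (d + 1) + 1 := by omega
    have l2 : n + 1 ≤ n + (d + 1) := by omega
    have l3 : n ≤ n + (d + 1) := by omega
    simp only [gb, l1, l2, l3, if_true, e1, e2, e3]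
    rw [qP_succ, ← fq_succ hq d, ← fq_succ hq n]
    ring

theorem gb_bdd {q : ℂ} (hq : ‖q‖ < 1) : ∃ M : ℝ, 1 ≤ M ∧ ∀ N n, ‖gb q N n‖ ≤ M := by
  obtain ⟨M, h1, hP, hf⟩ := q_bdd hq
  refine ⟨M * M * M, by nlinarith [mul_nonneg (by linarith : (0:ℝ) ≤ M) (by linarith : (0:ℝ) ≤ M)], fun N n => ?_⟩
  unfold gb
  split_ifs
  · rw [norm_mul, norm_mul]
    gcongr
    · exact hP _
    · exact hf _
    · exact hf _
  · rw [norm_zero]; positivity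

theorem gb_tendsto {q : ℂ} (hq : ‖q‖ < 1) (n : ℕ) :
    Tendsto (fun N => gb q N n) atTop (𝓝 (fq q n)) := by
  have h1 : Tendsto (fun N => qP q q N * fq q n * fq q (N - n)) atTop
      (𝓝 (qPInf q q * fq q n * (qPInf q q)⁻¹)) :=
    ((qP_tendsto hq).mul_const _).mul ((fq_tendsto hq).comp (tendsto_sub_atTop_nat n))
  have h2 : qPInf q q * fq q n * (qPInf q q)⁻¹ = fq q n := by
    field_simp [qPInf_ne hq]
  rw [h2] at h1
  refine h1.congr' ?_
  filter_upwards [eventually_ge_atTop n] with N hN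
  simp [gb, hN]

/-- The unified finite q-Vandermonde summation. -/
theorem vander {R : Type*} [CommRing R] [Algebra ℂ R] {q : ℂ} (hq : ‖q‖ < 1) (x : R) (N : ℕ) :
    ∀ (C : R) (i : ℕ → R), (∀ k, i k * (1 - C * algebraMap ℂ R (q ^ k)) = 1) →
    ∑ n ∈ range (N + 1), algebraMap ℂ R (gb q N n * (-1) ^ n * q ^ (c2 n)) *
      (∏ k ∈ range n, (x - C * algebraMap ℂ R (q ^ k))) * (∏ k ∈ range n, i k) =
    (∏ k ∈ range N, (1 - x * algebraMap ℂ R (q ^ k))) * ∏ k ∈ range N, i k := by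
  induction N with
  | zero => intro C i _; simp [gb, fq, qP_zero, c2_zero]
  | succ N ih =>
    intro C i hi
    have ih1 := ih C i hi
    have ih2 := ih (C * algebraMap ℂ R q) (fun k => i (k + 1)) (fun k => by
      have := hi (k + 1)
      rw [mul_assoc, ← map_mul, ← pow_succ']; exact this)
    set t : ℕ → R := fun n => algebraMap ℂ R ((-1) ^ n * q ^ (c2 n)) *
      (∏ k ∈ range n, (x - C * algebraMap ℂ R (q ^ k))) * (∏ k ∈ range n, i k) with ht
    set s : ℕ → R := fun n => algebraMap ℂ R ((-1) ^ n * q ^ (c2 n)) *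
      (∏ k ∈ range n, (x - C * algebraMap ℂ R q * algebraMap ℂ R (q ^ k))) *
      (∏ k ∈ range n, i (k + 1)) with hs
    have hts : ∀ n, t (n + 1) = - algebraMap ℂ R (q ^ n) * (x - C) * i 0 * s n := by
      intro n
      simp only [ht, hs]
      rw [prod_range_succ', prod_range_succ', c2_succ]
      simp only [pow_zero, map_one, mul_one, pow_succ', map_mul, mul_assoc, map_neg, pow_add]
      ring
    have e0 : ∀ (M : ℕ) (n : ℕ), algebraMap ℂ R (gb q M n * (-1) ^ n * q ^ (c2 n)) *
      (∏ k ∈ range n, (x - C * algebraMap ℂ R (q ^ k))) * (∏ k ∈ range n, i k)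
       = algebraMap ℂ R (gb q M n) * t n := by
      intro M n; simp only [ht, mul_assoc, map_mul]
    have e1 : ∀ (M : ℕ) (n : ℕ), algebraMap ℂ R (gb q M n * (-1) ^ n * q ^ (c2 n)) *
      (∏ k ∈ range n, (x - C * algebraMap ℂ R q * algebraMap ℂ R (q ^ k))) * (∏ k ∈ range n, i (k + 1))
       = algebraMap ℂ R (gb q M n) * s n := by
      intro M n; simp only [hs, mul_assoc, map_mul]
    simp only [e0] at ih1 ⊢
    simp only [e1] at ih2
    have key : ∑ n ∈ range (N + 1 + 1), algebraMap ℂ R (gb q (N + 1) n) * t n =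
        ∑ n ∈ range (N + 1), algebraMap ℂ R (gb q N n) * t n
        - algebraMap ℂ R (q ^ N) * (x - C) * i 0 *
          ∑ n ∈ range (N + 1), algebraMap ℂ R (gb q N n) * s n := by
      have z : ∑ n ∈ range (N + 1), algebraMap ℂ R (gb q N n) * t n =
          ∑ n ∈ range (N + 1 + 1), algebraMap ℂ R (gb q N n) * t n := by
        rw [sum_range_succ _ (N + 1), gb_of_lt (Nat.lt_succ_self N)]; simp
      rw [z, sum_range_succ', sum_range_succ' _ (N + 1), gb_zero hq, gb_zero hq, mul_sum]
      have : ∀ n ∈ range (N + 1), algebraMap ℂ R (gb q (N + 1) (n + 1)) * t (n + 1) =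
          algebraMap ℂ R (gb q N (n + 1)) * t (n + 1) -
          algebraMap ℂ R (q ^ N) * (x - C) * i 0 * (algebraMap ℂ R (gb q N n) * s n) := by
        intro n hn
        have hn' : n ≤ N := by simpa [Nat.lt_succ_iff] using hn
        rw [gb_pascal hq hn', map_add, add_mul, hts n, map_mul]
        have : q ^ N = q ^ (N - n) * q ^ n := by rw [← pow_add]; congr 1; omega
        rw [this, map_mul]
        ring
      rw [sum_congr rfl this, sum_sub_distrib]
      ring
    rw [key, ih1, ih2]
    have p1 : ∏ k ∈ range (N + 1), i k = (∏ k ∈ range N, i (k + 1)) * i 0 := prod_range_succ' _ _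
    have p2 : ∏ k ∈ range (N + 1), i k = (∏ k ∈ range N, i k) * i N := prod_range_succ _ _
    rw [prod_range_succ _ N]
    have hN := hi N
    set a := algebraMap ℂ R (q ^ N)
    set X := ∏ k ∈ range N, (1 - x * algebraMap ℂ R (q ^ k))
    set I := ∏ k ∈ range N, i k
    set J := ∏ k ∈ range N, i (k + 1)
    set I1 := ∏ k ∈ range (N + 1), i k
    have : I = I1 * (1 - C * a) := by rw [p2]; linear_combination -I * hN
    rw [this]
    linear_combination a * (x - C) * X * p1

open PowerSeries in
/-- inverse of `1 - q^k X^2` -/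
def ik (q : ℂ) (k : ℕ) : PowerSeries ℂ := (1 - (X : PowerSeries ℂ) ^ 2 * algebraMap ℂ (PowerSeries ℂ) (q ^ k))⁻¹

open PowerSeries in
theorem ik_mul (q : ℂ) (k : ℕ) :
    ik q k * (1 - (X : PowerSeries ℂ) ^ 2 * algebraMap ℂ (PowerSeries ℂ) (q ^ k)) = 1 := by
  unfold ik
  apply PowerSeries.inv_mul_cancel
  simp

def In (q : ℂ) (N : ℕ) : PowerSeries ℂ := ∏ k ∈ range N, ik q k

open PowerSeries in
def Zn (q : ℂ) (N : ℕ) : PowerSeries ℂ :=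
  ∏ k ∈ range N, (1 + (X : PowerSeries ℂ) * algebraMap ℂ (PowerSeries ℂ) (q ^ k))

def gN (q : ℂ) (N i : ℕ) : ℂ := qP q (q ^ N) i * fq q i

theorem gN_zero (q : ℂ) (N : ℕ) : gN q N 0 = 1 := by simp [gN, qP_zero, fq_zero]

theorem gN_rec {q : ℂ} (hq : ‖q‖ < 1) (N i : ℕ) :
    gN q (N + 1) (i + 1) - q ^ N * gN q (N + 1) i = gN q N (i + 1) := by
  have h1 : qP q (q ^ N) (i + 1) = qP q (q ^ (N + 1)) i * (1 - q ^ N) := by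
    unfold qP
    rw [prod_range_succ']
    congr 1
    · apply prod_congr rfl; intro m _; ring
    · simp
  have h2 : qP q (q ^ (N + 1)) (i + 1) = qP q (q ^ (N + 1)) i * (1 - q ^ (N + 1) * q ^ i) := by
    unfold qP; rw [prod_range_succ]
  unfold gN
  rw [h1, h2, ← fq_succ hq i]
  ring

theorem gN_bdd {q : ℂ} (hq : ‖q‖ < 1) : ∃ M : ℝ, 1 ≤ M ∧ ∀ N i, ‖gN q N i‖ ≤ M := by
  obtain ⟨M, h1, hP, hf⟩ := q_bdd hq
  have hM1 : 1 ≤ M * M * M := one_le_mul_of_one_le_of_one_le (one_le_mul_of_one_le_of_one_le h1 h1) h1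
  refine ⟨M * M * M, hM1, fun N i => ?_⟩
  rcases N with _ | N
  · rcases i with _ | i
    · rw [gN_zero]; simpa using hM1
    · have : gN q 0 (i + 1) = 0 := by
        unfold gN qP; rw [prod_range_succ']; simp
      rw [this, norm_zero]; linarith
  · have : gN q (N + 1) i = qP q q (N + i) * fq q N * fq q i := by
      unfold gN
      have : qP q q (N + i) = qP q q N * qP q (q ^ (N + 1)) i := by
        unfold qP
        rw [prod_range_add]
        congr 1
        apply prod_congr rfl; intro m _; ring
      rw [this, fq, fq]
      field_simp [qP_ne hq N]
    rw [this, norm_mul, norm_mul]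
    gcongr
    · exact hP _
    · exact hf _
    · exact hf _

theorem gN_tendsto {q : ℂ} (hq : ‖q‖ < 1) (i : ℕ) :
    Tendsto (fun N => gN q N i) atTop (𝓝 (fq q i)) := by
  have h : Tendsto (fun N : ℕ => q ^ N) atTop (𝓝 0) := tendsto_pow_atTop_nhds_zero_of_norm_lt_one hq
  have h2 : Tendsto (fun N : ℕ => qP q (q ^ N) i) atTop (𝓝 (∏ m ∈ range i, (1 - 0 * q ^ m))) := by
    unfold qP
    apply tendsto_finsetProd
    intro m _
    exact tendsto_const_nhds.sub (h.mul_const _)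
  have := h2.mul_const (fq q i)
  simpa [gN] using this

open PowerSeries in
def Yser (q : ℂ) (N : ℕ) : PowerSeries ℂ :=
  PowerSeries.mk fun p => if Even p then gN q N (p / 2) else 0

open PowerSeries in
theorem Yser_rec {q : ℂ} (hq : ‖q‖ < 1) (N : ℕ) :
    Yser q (N + 1) * (1 - (X : PowerSeries ℂ) ^ 2 * algebraMap ℂ (PowerSeries ℂ) (q ^ N)) = Yser q N := by
  ext p
  have : Yser q (N + 1) * (1 - (X : PowerSeries ℂ) ^ 2 * algebraMap ℂ (PowerSeries ℂ) (q ^ N)) =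
    Yser q (N + 1) - (PowerSeries.C (q ^ N)) * (X ^ 2 * Yser q (N + 1)) := by
    rw [PowerSeries.algebraMap_eq]; ring
  rw [this, map_sub, PowerSeries.coeff_C_mul, PowerSeries.coeff_X_pow_mul']
  unfold Yser
  simp only [PowerSeries.coeff_mk]
  rcases p with _ | _ | p
  · simp [gN_zero]
  · simp
  · have e : (p + 1 + 1) / 2 = p / 2 + 1 := by omega
    have e2 : p + 1 + 1 - 2 = p := by omega
    have e3 : Even (p + 1 + 1) ↔ Even p := by
      simp [Nat.even_add_one]
    simp only [e, e2, e3]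
    by_cases hp : Even p
    · simp only [hp, if_true, ← gN_rec hq N (p / 2)]
      simp
    · simp [hp]

theorem Yser_zero (q : ℂ) : Yser q 0 = 1 := by
  ext p
  unfold Yser
  rw [PowerSeries.coeff_mk, PowerSeries.coeff_one]
  rcases Nat.eq_zero_or_pos p with rfl | hp
  · simp [gN_zero]
  · split_ifs with h1 h2
    · omega
    · obtain ⟨m, rfl⟩ := h1
      have : (m + m) / 2 = (m - 1) + 1 := by omega
      rw [this]
      unfold gN qP; rw [prod_range_succ']; simp
    · omega
    · rfl

theorem In_eq {q : ℂ} (hq : ‖q‖ < 1) (N : ℕ) : In q N = Yser q N := by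
  induction N with
  | zero => simp [In, Yser_zero]
  | succ N ih =>
    rw [In, prod_range_succ, ← In, ih, ← Yser_rec hq N, mul_assoc, mul_comm _ (ik q N), ik_mul, mul_one]

theorem coeff_In {q : ℂ} (hq : ‖q‖ < 1) (N p : ℕ) :
    PowerSeries.coeff p (In q N) = if Even p then gN q N (p / 2) else 0 := by
  rw [In_eq hq, Yser, PowerSeries.coeff_mk]

theorem prod_q_pow (q : ℂ) (n : ℕ) : ∏ k ∈ range n, q ^ k = q ^ (c2 n) := by
  induction n with
  | zero => simp [c2_zero]
  | succ n ih => rw [prod_range_succ, ih, c2_succ, pow_add]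

theorem Tlem {R : Type*} [CommRing R] [Algebra ℂ R] {q : ℂ} (hq : ‖q‖ < 1) (N : ℕ)
    (w : R) (i : ℕ → R) (hi : ∀ k, i k * (1 - w * algebraMap ℂ R (q ^ k)) = 1) :
    ∑ n ∈ range (N + 1), algebraMap ℂ R (gb q N n * q ^ (2 * c2 n)) * w ^ n * (∏ k ∈ range n, i k) =
    ∏ k ∈ range N, i k := by
  have h := vander hq 0 N w i hi
  simp only [zero_mul, sub_zero, prod_const_one, one_mul] at h
  rw [← h]
  apply sum_congr rfl
  intro n _
  have : ∏ k ∈ range n, (0 - w * algebraMap ℂ R (q ^ k)) = w ^ n * algebraMap ℂ R ((-1) ^ n * q ^ (c2 n)) := by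
    have : ∀ k ∈ range n, (0 - w * algebraMap ℂ R (q ^ k)) = w * (algebraMap ℂ R (-1) * algebraMap ℂ R (q ^ k)) := by
      intro k _; simp
    rw [prod_congr rfl this, prod_mul_distrib, prod_mul_distrib, prod_const, prod_const, card_range,
      ← map_prod, prod_q_pow, ← map_pow, ← map_mul]
  rw [this, two_mul, pow_add]
  have h1 : ((-1 : ℂ)) ^ n * (-1) ^ n = 1 := by rw [← mul_pow]; simp
  have h2 : (gb q N n * (q ^ (c2 n) * q ^ (c2 n))) =
    (gb q N n * (-1) ^ n * q ^ (c2 n)) * ((-1) ^ n * q ^ (c2 n)) := by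
    linear_combination - gb q N n * (q ^ (c2 n) * q ^ (c2 n)) * h1
  rw [h2, map_mul]; ring

theorem coeff_Zn {q : ℂ} (hq : ‖q‖ < 1) (n u : ℕ) :
    PowerSeries.coeff u (Zn q n) = q ^ (c2 u) * gb q n u := by
  have h := vander (R := PowerSeries ℂ) hq (-PowerSeries.X) n 0 (fun _ => 1) (by simp)
  have h2 : Zn q n = ∑ m ∈ range (n + 1), PowerSeries.C (gb q n m * q ^ (c2 m)) * PowerSeries.X ^ m := by
    have e : ∀ k, (1 - -(PowerSeries.X : PowerSeries ℂ) * algebraMap ℂ (PowerSeries ℂ) (q ^ k)) =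
      1 + (PowerSeries.X : PowerSeries ℂ) * algebraMap ℂ (PowerSeries ℂ) (q ^ k) := by intro k; ring
    simp only [e, prod_const_one, mul_one, zero_mul, sub_zero, prod_const, card_range] at h
    rw [Zn, ← h]
    apply sum_congr rfl
    intro m _
    rw [PowerSeries.algebraMap_eq, neg_pow (PowerSeries.X : PowerSeries ℂ) m]
    have : ((-1 : PowerSeries ℂ)) ^ m = PowerSeries.C ((-1) ^ m) := by simp
    rw [this, ← mul_assoc, ← map_mul]
    congr 2
    have h1 : ((-1 : ℂ)) ^ m * (-1) ^ m = 1 := by rw [← mul_pow]; simp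
    linear_combination gb q n m * q ^ (c2 m) * h1
  rw [h2, map_sum]
  simp only [PowerSeries.coeff_C_mul, PowerSeries.coeff_X_pow, mul_ite, mul_one, mul_zero]
  rw [Finset.sum_ite_eq]
  split_ifs with h
  · ring
  · rw [gb_of_lt (by simpa using h)]; simp

local notation "PC" => algebraMap ℂ (PowerSeries ℂ)
local notation "PX" => (PowerSeries.X : PowerSeries ℂ)

def Dn (q : ℂ) (n : ℕ) : PowerSeries ℂ := PC (fq q n * (1 - q ^ n)) * In q (n + 1)

def Wn (q : ℂ) (l n : ℕ) : PowerSeries ℂ := PC (fq q n) * In q n - PX ^ (2 * l) * Dn q n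

theorem In_succ (q : ℂ) (n : ℕ) : In q (n + 1) = In q n * ik q n := by
  rw [In, prod_range_succ, ← In]

theorem In_eq_succ (q : ℂ) (n : ℕ) : In q n = In q (n + 1) * (1 - PX ^ 2 * PC (q ^ n)) := by
  rw [In_succ, mul_assoc, ik_mul, mul_one]

theorem In_two (q : ℂ) (n : ℕ) :
    In q (n + 2) = ik q 0 * ik q 1 * ∏ k ∈ range n, ik q (k + 2) := by
  rw [In, prod_range_succ', prod_range_succ']; ring

theorem Dn_zero (q : ℂ) : Dn q 0 = 0 := by simp [Dn]

theorem Dn_succ {q : ℂ} (hq : ‖q‖ < 1) (n : ℕ) : Dn q (n + 1) = PC (fq q n) * In q (n + 2) := by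
  rw [Dn, fq_succ hq]

theorem Wn_zero (q : ℂ) (n : ℕ) : Wn q 0 n = PC (q ^ n) * Wn q 1 n := by
  simp only [Wn, Dn, In_eq_succ q n, map_mul, map_sub, map_one]
  ring

theorem gb_fq {q : ℂ} (hq : ‖q‖ < 1) {n r : ℕ} (h : r ≤ n) :
    fq q n * gb q n r = fq q (n - r) * fq q r := by
  simp only [gb, h, if_true]
  have : fq q n * qP q q n = 1 := inv_mul_cancel₀ (qP_ne hq n)
  linear_combination fq q (n - r) * fq q r * this

theorem ik_shift (q : ℂ) (k : ℕ) :
    ik q (k + 2) * (1 - PX ^ 2 * PC (q ^ 2) * PC (q ^ k)) = 1 := by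
  have := ik_mul q (k + 2)
  rw [mul_assoc, ← map_mul, ← pow_add, add_comm 2 k]; exact this

theorem rec_I {q : ℂ} (hq : ‖q‖ < 1) (n : ℕ) :
    ∑ r ∈ range (n + 1), PC (fq q (n - r) * q ^ (2 * c2 r)) * PX ^ (2 * r) * (PC (fq q r) * In q r)
      = PC (fq q n) * In q n := by
  have h := Tlem (R := PowerSeries ℂ) hq n (PX ^ 2) (ik q) (ik_mul q)
  rw [In, ← h, mul_sum]
  apply sum_congr rfl
  intro r hr
  have hr' : r ≤ n := by simpa [Nat.lt_succ_iff] using hr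
  have e := gb_fq hq hr'
  rw [← In, pow_mul PX 2 r]
  have : PC (fq q n) * PC (gb q n r) = PC (fq q (n - r)) * PC (fq q r) := by
    rw [← map_mul, e, map_mul]
  simp only [map_mul]
  linear_combination - PC (q ^ (2 * c2 r)) * (PX ^ 2) ^ r * In q r * this

theorem rec_D {q : ℂ} (hq : ‖q‖ < 1) (n : ℕ) :
    ∑ r ∈ range (n + 1), PC (fq q (n - r) * q ^ (2 * c2 r)) * PX ^ (2 * r) * Dn q r
      = PX ^ 2 * Dn q n := by
  rcases n with _ | n
  · simp [Dn_zero]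
  rw [sum_range_succ', Dn_zero, mul_zero, add_zero, Dn_succ hq, In_two]
  have h := Tlem (R := PowerSeries ℂ) hq n (PX ^ 2 * PC (q ^ 2)) (fun k => ik q (k + 2)) (ik_shift q)
  rw [← h, mul_sum, mul_sum, mul_sum]
  apply sum_congr rfl
  intro r hr
  have hr' : r ≤ n := by simpa [Nat.lt_succ_iff] using hr
  have e := gb_fq hq hr'
  have : PC (fq q n) * PC (gb q n r) = PC (fq q (n - r)) * PC (fq q r) := by
    rw [← map_mul, e, map_mul]
  rw [Dn_succ hq, In_two, Nat.add_sub_add_right, c2_succ]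
  have e2 : q ^ (2 * (c2 r + r)) = q ^ (2 * c2 r) * (q ^ 2) ^ r := by ring
  rw [e2, mul_pow, ← map_pow]
  simp only [map_mul]
  have e3 : PX ^ (2 * (r + 1)) = PX ^ 2 * (PX ^ 2) ^ r := by ring
  rw [e3]
  linear_combination - PX ^ 2 * (PX ^ 2) ^ r * PC (q ^ (2 * c2 r)) * PC ((q ^ 2) ^ r) * ik q 0 * ik q 1 *
    (∏ k ∈ range r, ik q (k + 2)) * this

theorem Wn_rec {q : ℂ} (hq : ‖q‖ < 1) (l n : ℕ) :
    ∑ r ∈ range (n + 1), PC (fq q (n - r) * q ^ (2 * c2 r)) * PX ^ (2 * r) * Wn q l r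
      = Wn q (l + 1) n := by
  have e : PX ^ (2 * (l + 1)) = PX ^ (2 * l) * PX ^ 2 := by ring
  rw [Wn, ← rec_I hq, e, mul_assoc, ← rec_D hq, mul_sum, ← sum_sub_distrib]
  apply sum_congr rfl
  intro r _
  rw [Wn]; ring

theorem Wn_n0 {q : ℂ} (l : ℕ) : Wn q l 0 = 1 := by
  simp [Wn, Dn_zero, fq_zero, In]

def E1 (q : ℂ) : PowerSeries ℂ := PowerSeries.mk fun u => q ^ (c2 u) * fq q u
def E2 (q : ℂ) : PowerSeries ℂ := PowerSeries.mk fun p => if Even p then fq q (p / 2) else 0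

theorem coeff_tendsto_E {q : ℂ} (hq : ‖q‖ < 1) (K a b : ℕ) :
    Tendsto (fun N => PowerSeries.coeff K (Zn q (N + a) * In q (N + b))) atTop
      (𝓝 (PowerSeries.coeff K (E1 q * E2 q))) := by
  simp only [PowerSeries.coeff_mul, coeff_Zn hq, coeff_In hq, E1, E2, PowerSeries.coeff_mk]
  apply tendsto_finsetSum
  rintro ⟨u, p⟩ _
  apply Tendsto.mul
  · exact tendsto_const_nhds.mul ((gb_tendsto hq u).comp (tendsto_add_atTop_nat a))
  · by_cases hp : Even p
    · simp only [hp, if_true]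
      exact (gN_tendsto hq _).comp (tendsto_add_atTop_nat b)
    · simp only [hp, if_false]; exact tendsto_const_nhds

/-- extraction of limits: from finite identities to coefficient identities -/
theorem lim_extract {q : ℂ} (hq : ‖q‖ < 1) (c : ℕ) (A : ℕ → PowerSeries ℂ) (G : ℕ → PowerSeries ℂ)
    (G0 : ℂ) (K : ℕ)
    (h : ∀ N, ∑ n ∈ range (N + 1), PC (gb q N n) * (PX ^ (n + c) * A n) = G N)
    (hG : Tendsto (fun N => PowerSeries.coeff K (G N)) atTop (𝓝 G0)) :
    ∑ n ∈ range (K + 1), fq q n * PowerSeries.coeff K (PX ^ (n + c) * A n) = G0 := by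
  refine tendsto_nhds_unique ?_ hG
  have h1 : Tendsto (fun N => ∑ n ∈ range (K + 1), gb q N n * PowerSeries.coeff K (PX ^ (n + c) * A n)) atTop
      (𝓝 (∑ n ∈ range (K + 1), fq q n * PowerSeries.coeff K (PX ^ (n + c) * A n))) := by
    apply tendsto_finsetSum
    intro n _
    exact (gb_tendsto hq n).mul_const _
  refine h1.congr' ?_
  filter_upwards [eventually_ge_atTop K] with N hN
  rw [← h, map_sum]
  simp only [PowerSeries.algebraMap_eq, PowerSeries.coeff_C_mul]
  apply sum_subset
  · intro n; simp only [mem_range]; omega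
  · intro n _ hn
    rw [PowerSeries.coeff_X_pow_mul', if_neg, mul_zero]
    simp only [mem_range] at hn; omega

theorem Zn_succ_shift (q : ℂ) (n : ℕ) :
    Zn q (n + 1) = (1 + PX) * ∏ k ∈ range n, (1 + PX * PC q * PC (q ^ k)) := by
  rw [Zn, prod_range_succ', mul_comm]
  congr 1
  · simp
  · apply prod_congr rfl
    intro k _
    rw [mul_assoc, ← map_mul, ← pow_succ']

theorem F1fin {q : ℂ} (hq : ‖q‖ < 1) (N : ℕ) :
    ∑ n ∈ range (N + 1), PC (gb q N n) * (PX ^ (n + 0) * (PC (q ^ (c2 n)) * Zn q n * In q n))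
      = Zn q N * In q N := by
  have h := vander (R := PowerSeries ℂ) hq (-PX) N (PX ^ 2) (ik q) (ik_mul q)
  have e : ∀ k, (1 - -PX * PC (q ^ k)) = 1 + PX * PC (q ^ k) := by intro k; ring
  simp only [e] at h
  rw [← Zn, ← In] at h
  rw [← h]
  apply sum_congr rfl
  intro n _
  have e2 : ∏ k ∈ range n, (-PX - PX ^ 2 * PC (q ^ k)) = (-PX) ^ n * Zn q n := by
    have : ∀ k ∈ range n, (-PX - PX ^ 2 * PC (q ^ k)) = -PX * (1 + PX * PC (q ^ k)) := by
      intro k _; ring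
    rw [prod_congr rfl this, prod_mul_distrib, prod_const, card_range, Zn]
  have h1 : ((-1 : PowerSeries ℂ)) ^ n * (-1) ^ n = 1 := by rw [← mul_pow]; simp
  rw [e2, ← In, neg_pow PX n]
  simp only [map_mul, map_pow, map_neg, map_one, add_zero]
  linear_combination - PC (gb q N n) * (PX ^ n * (PC q ^ (c2 n) * Zn q n * In q n)) * h1

theorem F2fin {q : ℂ} (hq : ‖q‖ < 1) (N : ℕ) :
    ∑ n ∈ range (N + 1), PC (gb q N n) *
      (PX ^ (n + 1) * (PC (q ^ (c2 ((n + 1 : ℕ) : ℤ))) * Zn q (n + 1) * In q (n + 2)))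
      = PX * (Zn q (N + 1) * In q (N + 2)) := by
  have h := vander (R := PowerSeries ℂ) hq (-(PX * PC q)) N (PX ^ 2 * PC (q ^ 2)) (fun k => ik q (k + 2))
    (ik_shift q)
  have e : ∀ k, (1 - -(PX * PC q) * PC (q ^ k)) = 1 + PX * PC q * PC (q ^ k) := by intro k; ring
  simp only [e] at h
  rw [Zn_succ_shift, In_two]
  have : PX * ((1 + PX) * (∏ k ∈ range N, (1 + PX * PC q * PC (q ^ k))) *
     (ik q 0 * ik q 1 * ∏ k ∈ range N, ik q (k + 2))) = PX * (1 + PX) * ik q 0 * ik q 1 *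
     ((∏ k ∈ range N, (1 + PX * PC q * PC (q ^ k))) * (∏ k ∈ range N, ik q (k + 2))) := by ring
  rw [this, ← h, mul_sum]
  apply sum_congr rfl
  intro n _
  have e2 : ∏ k ∈ range n, (-(PX * PC q) - PX ^ 2 * PC (q ^ 2) * PC (q ^ k)) =
     (-(PX * PC q)) ^ n * ∏ k ∈ range n, (1 + PX * PC q * PC (q ^ k)) := by
    have : ∀ k ∈ range n, (-(PX * PC q) - PX ^ 2 * PC (q ^ 2) * PC (q ^ k)) =
        -(PX * PC q) * (1 + PX * PC q * PC (q ^ k)) := by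
      intro k _; simp only [map_pow]; ring
    rw [prod_congr rfl this, prod_mul_distrib, prod_const, card_range]
  have h1 : ((-1 : PowerSeries ℂ)) ^ n * (-1) ^ n = 1 := by rw [← mul_pow]; simp
  rw [e2, neg_pow (PX * PC q) n, Zn_succ_shift, In_two, c2_succ]
  simp only [map_mul, map_pow, map_neg, map_one, pow_add, mul_pow]
  set Z := ∏ k ∈ range n, (1 + PX * PC q * (PC q) ^ k)
  set J := ∏ k ∈ range n, ik q (k + 2)
  linear_combination - PC (gb q N n) * (PX ^ n * PX ^ 1 * (PC q ^ (c2 n) * PC q ^ n * ((1 + PX) * Z) * (ik q 0 * ik q 1 * J))) * h1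

def eK (q : ℂ) (K : ℕ) : ℂ := PowerSeries.coeff K (E1 q * E2 q)

theorem F1 {q : ℂ} (hq : ‖q‖ < 1) (K : ℕ) :
    ∑ n ∈ range (K + 1), PowerSeries.coeff K (PX ^ n * (PC (q ^ (c2 n)) * Zn q n * (PC (fq q n) * In q n)))
      = eK q K := by
  have := lim_extract hq 0 _ _ (eK q K) K (F1fin hq) (coeff_tendsto_E hq K 0 0)
  rw [← this]
  apply sum_congr rfl
  intro n _
  rw [← PowerSeries.coeff_C_mul, ← PowerSeries.algebraMap_eq]
  congr 1
  simp only [add_zero]; ring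

theorem F2 {q : ℂ} (hq : ‖q‖ < 1) (K : ℕ) :
    ∑ n ∈ range (K + 1), PowerSeries.coeff K (PX ^ n * (PC (q ^ (c2 n)) * Zn q n * Dn q n))
      = if 1 ≤ K then eK q (K - 1) else 0 := by
  have hG : Tendsto (fun N => PowerSeries.coeff K (PX * (Zn q (N + 1) * In q (N + 2)))) atTop
      (𝓝 (if 1 ≤ K then eK q (K - 1) else 0)) := by
    have : ∀ N, PowerSeries.coeff K (PX * (Zn q (N + 1) * In q (N + 2))) =
       if 1 ≤ K then PowerSeries.coeff (K - 1) (Zn q (N + 1) * In q (N + 2)) else 0 := by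
      intro N
      have := PowerSeries.coeff_X_pow_mul' (Zn q (N + 1) * In q (N + 2)) 1 K
      rwa [pow_one] at this
    simp only [this]
    split_ifs
    · exact coeff_tendsto_E hq (K - 1) 1 2
    · exact tendsto_const_nhds
  have := lim_extract hq 1 _ _ _ K (F2fin hq) hG
  rw [← this, sum_range_succ', sum_range_succ, Dn_zero]
  have z : PowerSeries.coeff K
     (PX ^ (K + 1) * (PC (q ^ (c2 ((K + 1 : ℕ) : ℤ))) * Zn q (K + 1) * In q (K + 2))) = 0 := by
    rw [PowerSeries.coeff_X_pow_mul', if_neg (by omega)]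
  rw [z, mul_zero, mul_zero, mul_zero, map_zero]
  congr 1
  apply sum_congr rfl
  intro n _
  rw [← PowerSeries.coeff_C_mul, ← PowerSeries.algebraMap_eq, Dn_succ hq]
  congr 1
  ring

theorem phi {q : ℂ} (hq : ‖q‖ < 1) (l K : ℕ) :
    ∑ n ∈ range (K + 1), PowerSeries.coeff K (PX ^ n * (PC (q ^ (c2 n)) * Zn q n * Wn q l n))
      = eK q K - if 2 * l + 1 ≤ K then eK q (K - (2 * l + 1)) else 0 := by
  have e : ∀ n : ℕ, PX ^ n * (PC (q ^ (c2 n)) * Zn q n * Wn q l n) =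
     PX ^ n * (PC (q ^ (c2 n)) * Zn q n * (PC (fq q n) * In q n)) -
     PX ^ (2 * l) * (PX ^ n * (PC (q ^ (c2 n)) * Zn q n * Dn q n)) := by
    intro n; rw [Wn]; ring
  simp only [e, map_sub]
  rw [sum_sub_distrib, F1 hq]
  congr 1
  simp only [PowerSeries.coeff_X_pow_mul' _ (2 * l) K]
  by_cases h : 2 * l ≤ K
  · simp only [h, if_true]
    have h2 := F2 hq (K - 2 * l)
    have : ∑ n ∈ range (K + 1), PowerSeries.coeff (K - 2 * l) (PX ^ n * (PC (q ^ (c2 n)) * Zn q n * Dn q n)) =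
       ∑ n ∈ range (K - 2 * l + 1), PowerSeries.coeff (K - 2 * l) (PX ^ n * (PC (q ^ (c2 n)) * Zn q n * Dn q n)) := by
      symm
      apply sum_subset
      · intro n; simp only [mem_range]; omega
      · intro n _ hn
        rw [PowerSeries.coeff_X_pow_mul', if_neg]
        simp only [mem_range] at hn; omega
    rw [this, h2]
    by_cases h3 : 2 * l + 1 ≤ K
    · rw [if_pos h3, if_pos (by omega)]; congr 1
    · rw [if_neg h3, if_neg (by omega)]
  · simp only [h, if_false, sum_const_zero]
    rw [if_neg (by omega)]

theorem Wn_bdd {q : ℂ} (hq : ‖q‖ < 1) (l : ℕ) :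
    ∃ M : ℝ, 1 ≤ M ∧ ∀ n p, ‖PowerSeries.coeff p (Wn q l n)‖ ≤ M := by
  obtain ⟨M, h1, hP, hf⟩ := q_bdd hq
  obtain ⟨B, hB1, hB⟩ := gN_bdd hq
  have hI : ∀ n p, ‖PowerSeries.coeff p (In q n)‖ ≤ B := by
    intro n p; rw [coeff_In hq]; split_ifs
    · exact hB _ _
    · rw [norm_zero]; linarith
  have hone : ∀ n : ℕ, ‖1 - q ^ n‖ ≤ 2 := by
    intro n
    calc ‖1 - q ^ n‖ ≤ ‖(1 : ℂ)‖ + ‖q ^ n‖ := norm_sub_le _ _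
      _ ≤ 1 + 1 := by
        rw [norm_one, norm_pow]
        gcongr
        exact pow_le_one₀ (norm_nonneg _) hq.le
      _ = 2 := by norm_num
  have hD : ∀ n p, ‖PowerSeries.coeff p (Dn q n)‖ ≤ M * 2 * B := by
    intro n p
    rw [Dn, PowerSeries.algebraMap_eq, PowerSeries.coeff_C_mul, norm_mul, norm_mul]
    gcongr
    · exact hf _
    · exact hone _
    · exact hI _ _
  have hMB : 1 ≤ M * B := one_le_mul_of_one_le_of_one_le h1 hB1
  refine ⟨M * B + M * 2 * B, by nlinarith, fun n p => ?_⟩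
  rw [Wn, map_sub]
  refine (norm_sub_le _ _).trans (add_le_add ?_ ?_)
  · rw [PowerSeries.algebraMap_eq, PowerSeries.coeff_C_mul, norm_mul]
    gcongr
    · exact hf _
    · exact hI _ _
  · rw [PowerSeries.coeff_X_pow_mul']
    split_ifs
    · exact hD _ _
    · rw [norm_zero]; positivity

theorem Wn_odd {q : ℂ} (hq : ‖q‖ < 1) (l n p : ℕ) (hp : ¬ Even p) :
    PowerSeries.coeff p (Wn q l n) = 0 := by
  rw [Wn, map_sub, PowerSeries.algebraMap_eq, PowerSeries.coeff_C_mul, PowerSeries.coeff_X_pow_mul', coeff_In hq,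
    if_neg hp]
  split_ifs with h
  · rw [Dn, PowerSeries.algebraMap_eq, PowerSeries.coeff_C_mul, coeff_In hq, if_neg]
    · simp
    · intro h2
      apply hp
      have : p = p - 2 * l + 2 * l := by omega
      rw [this]
      exact h2.add (even_two_mul l)
  · simp

namespace Ptn

theorem ext' {P Q : Ptn} (h : ∀ i, P.p i = Q.p i) : P = Q := by
  cases P; cases Q
  congr
  exact Finsupp.ext h

/-- remove the first part -/
def tl (P : Ptn) : Ptn where
  p := P.p.comapDomain Nat.succ (Nat.succ_injective.injOn)
  mono := by
    intro i j h
    simp only [Finsupp.comapDomain_apply]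
    exact P.mono (Nat.succ_le_succ h)

theorem tl_p (P : Ptn) (i : ℕ) : P.tl.p i = P.p (i + 1) := by
  simp [tl, Finsupp.comapDomain_apply]

/-- prepend a first part -/
def cns (n : ℕ) (P : Ptn) (h : P.p 0 ≤ n) : Ptn where
  p := Finsupp.onFinset (insert 0 (P.p.support.image Nat.succ))
    (fun i => match i with | 0 => n | i + 1 => P.p i) (by
      intro i hi
      rcases i with _ | i
      · simp
      · simp only [mem_insert, mem_image]
        right
        exact ⟨i, by simpa using hi, rfl⟩)
  mono := by
    intro i j hij
    simp only [Finsupp.onFinset_apply]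
    rcases i with _ | i
    · rcases j with _ | j
      · exact le_rfl
      · exact (P.mono (Nat.zero_le j)).trans h
    · rcases j with _ | j
      · omega
      · exact P.mono (by omega)

theorem cns_zero (n : ℕ) (P : Ptn) (h : P.p 0 ≤ n) : (cns n P h).p 0 = n := by
  simp [cns]

theorem cns_succ (n : ℕ) (P : Ptn) (h : P.p 0 ≤ n) (i : ℕ) : (cns n P h).p (i + 1) = P.p i := by
  simp [cns]

theorem tl_cns (n : ℕ) (P : Ptn) (h : P.p 0 ≤ n) : (cns n P h).tl = P := by
  apply ext'; intro i; rw [tl_p, cns_succ]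

theorem tl_le (P : Ptn) : P.tl.p 0 ≤ P.p 0 := by rw [tl_p]; exact P.mono (by omega)

theorem cns_tl (P : Ptn) : cns (P.p 0) P.tl P.tl_le = P := by
  apply ext'; intro i
  rcases i with _ | i
  · rw [cns_zero]
  · rw [cns_succ, tl_p]

/-- a bound for the support -/
def bd (P : Ptn) : ℕ := P.p.support.sup id + 1

theorem supp_sub (P : Ptn) {M : ℕ} (hM : P.bd ≤ M) : P.p.support ⊆ range M := by
  intro i hi
  have : i ≤ P.p.support.sup id := le_sup (f := id) hi
  rw [mem_range]; unfold bd at hM; omega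

theorem wt_eq (P : Ptn) {M : ℕ} (hM : P.bd ≤ M) : P.wt = ∑ i ∈ range M, P.p i := by
  rw [wt, Finsupp.sum]
  apply sum_subset (P.supp_sub hM)
  intro i _ hi
  simpa using hi

/-- sum of squares -/
def s2 (P : Ptn) : ℕ := P.p.sum fun _ v => v * v

theorem s2_eq (P : Ptn) {M : ℕ} (hM : P.bd ≤ M) : P.s2 = ∑ i ∈ range M, P.p i * P.p i := by
  rw [s2, Finsupp.sum]
  apply sum_subset (P.supp_sub hM)
  intro i _ hi
  have : P.p i = 0 := by simpa using hi
  simp [this]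

theorem bConj_eq (q : ℂ) (P : Ptn) {M : ℕ} (hM : P.bd ≤ M) :
    bConj q P = ∏ i ∈ range M, qP q q (P.p i - P.p (i + 1)) := by
  rw [bConj]
  apply prod_subset (P.supp_sub hM)
  intro i _ hi
  have : P.p i = 0 := by simpa using hi
  simp [this, qP_zero]

theorem wt_tl (P : Ptn) : P.wt = P.p 0 + P.tl.wt := by
  rw [P.wt_eq (M := max P.bd P.tl.bd + 1) (by omega), P.tl.wt_eq (M := max P.bd P.tl.bd) (by omega),
    sum_range_succ', add_comm]
  simp only [tl_p]

theorem s2_tl (P : Ptn) : P.s2 = P.p 0 * P.p 0 + P.tl.s2 := by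
  rw [P.s2_eq (M := max P.bd P.tl.bd + 1) (by omega), P.tl.s2_eq (M := max P.bd P.tl.bd) (by omega),
    sum_range_succ', add_comm]
  simp only [tl_p]

theorem bConj_tl (q : ℂ) (P : Ptn) : bConj q P = qP q q (P.p 0 - P.tl.p 0) * bConj q P.tl := by
  rw [bConj_eq q P (M := max P.bd P.tl.bd + 1) (by omega),
    bConj_eq q P.tl (M := max P.bd P.tl.bd) (by omega),
    prod_range_succ', mul_comm]
  simp only [tl_p]

theorem headSum_tl (P : Ptn) (l : ℕ) : P.headSum (l + 1) = P.p 0 + P.tl.headSum l := by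
  rw [headSum, headSum, sum_range_succ', add_comm]
  simp only [tl_p]

theorem headSum_le_wt (P : Ptn) (l : ℕ) : P.headSum l ≤ P.wt := by
  rw [P.wt_eq (M := max P.bd l) (by omega), headSum]
  apply sum_le_sum_of_subset
  intro i; simp only [mem_range]; omega

theorem wt_le_s2 (P : Ptn) : P.wt ≤ P.s2 := by
  rw [wt, s2, Finsupp.sum, Finsupp.sum]
  apply sum_le_sum
  intro i _
  exact Nat.le_mul_self _

theorem nConj_eq (P : Ptn) : 2 * P.nConj + P.wt = P.s2 := by
  have h : P.nConj = ∑ k ∈ P.p.support, ∑ i ∈ range (P.p k), i := by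
    unfold nConj conj
    have : ∀ i ∈ range (P.p 0), i * (P.p.support.filter fun k => i + 1 ≤ P.p k).card =
        ∑ k ∈ P.p.support, if i + 1 ≤ P.p k then i else 0 := by
      intro i _
      rw [← sum_filter, sum_const, smul_eq_mul, mul_comm]
    rw [sum_congr rfl this, sum_comm]
    apply sum_congr rfl
    intro k _
    rw [← sum_filter]
    apply sum_congr _ (fun _ _ => rfl)
    ext i
    have := P.mono (Nat.zero_le k)
    simp only [mem_filter, mem_range]; omega
  rw [h, wt, s2, Finsupp.sum, Finsupp.sum, mul_sum, ← sum_add_distrib]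
  apply sum_congr rfl
  intro k _
  have := Finset.sum_range_id_mul_two (P.p k)
  rw [mul_comm 2, this]
  rcases P.p k with _ | a
  · rfl
  · simp; ring

theorem p_le_wt (P : Ptn) (i : ℕ) : P.p i ≤ P.wt := by
  by_cases h : i ∈ P.p.support
  · rw [wt, Finsupp.sum]
    exact single_le_sum (f := fun i => P.p i) (fun _ _ => Nat.zero_le _) h
  · have : P.p i = 0 := by simpa using h
    omega

theorem p_ge_wt (P : Ptn) {i : ℕ} (h : P.wt ≤ i) : P.p i = 0 := by
  by_contra hne
  have h1 : 1 ≤ P.p i := by omega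
  have h2 : ∑ k ∈ range (i + 1), P.p k ≤ P.wt := by
    have := P.headSum_le_wt (i + 1)
    exact this
  have h3 : ∑ k ∈ range (i + 1), 1 ≤ ∑ k ∈ range (i + 1), P.p k := by
    apply sum_le_sum
    intro k hk
    have := P.mono (show k ≤ i by simp at hk; omega)
    omega
  simp at h3
  omega

theorem finite_wt (L : ℕ) : {P : Ptn | P.wt = L}.Finite := by
  have : Finite {P : Ptn | P.wt = L} := by
    let φ : {P : Ptn | P.wt = L} → (Fin L → Fin (L + 1)) := fun P i =>
      ⟨P.1.p i, by
        have := P.1.p_le_wt i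
        have h := P.2
        simp only [Set.mem_ofPred_eq] at h
        omega⟩
    apply Finite.of_injective φ
    rintro ⟨P, hP⟩ ⟨Q, hQ⟩ h
    simp only [Set.mem_ofPred_eq] at hP hQ
    apply Subtype.ext
    apply ext'
    intro i
    by_cases hi : i < L
    · have := congrFun h ⟨i, hi⟩
      simpa [φ] using this
    · rw [P.p_ge_wt (by omega), Q.p_ge_wt (by omega)]
  exact this

end Ptn

open Classical in
/-- partitions with first part `n`, weight `L` -/
def Fb (n L : ℕ) : Finset Ptn := (Ptn.finite_wt L).toFinset.filter fun P => P.p 0 = n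

theorem mem_Fb {n L : ℕ} {P : Ptn} : P ∈ Fb n L ↔ P.p 0 = n ∧ P.wt = L := by
  simp [Fb, and_comm]

/-- exponent -/
def ex (l : ℕ) (P : Ptn) : ℕ := P.s2 + P.p 0 - P.p 0 * P.p 0 - P.headSum l

theorem ex_succ_add (l : ℕ) (P : Ptn) : ex (l + 1) P + P.tl.headSum l = P.tl.s2 := by
  have h1 := P.s2_tl
  have h2 := P.headSum_tl l
  have h3 := P.tl.headSum_le_wt l
  have h4 := P.tl.wt_le_s2
  unfold ex
  omega

theorem ex_cast (l : ℕ) (P : Ptn) : (ex l P : ℤ) =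
    P.s2 + P.p 0 - P.p 0 * P.p 0 - P.headSum l := by
  have h1 := P.s2_tl
  rcases l with _ | l
  · have : P.headSum 0 = 0 := by simp [Ptn.headSum]
    unfold ex
    push_cast [h1, this]
    rw [show P.p 0 * P.p 0 + P.tl.s2 + P.p 0 - P.p 0 * P.p 0 - 0 = P.tl.s2 + P.p 0 by omega]
    push_cast; ring
  · have h := ex_succ_add l P
    have h2 := P.headSum_tl l
    have : (ex (l + 1) P : ℤ) + P.tl.headSum l = P.tl.s2 := by exact_mod_cast h
    rw [h1, h2]
    push_cast
    linarith

theorem ex_succ (l : ℕ) (P : Ptn) : ex (l + 1) P = ex l P.tl + 2 * c2 (P.tl.p 0) := by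
  have h1 := ex_succ_add l P
  have h2 := ex_cast l P.tl
  have h3 := c2_two (P.tl.p 0)
  have h4 : (ex (l + 1) P : ℤ) + P.tl.headSum l = P.tl.s2 := by exact_mod_cast h1
  have : (ex (l + 1) P : ℤ) = ex l P.tl + 2 * c2 (P.tl.p 0) := by
    rw [h2, h3]; linarith
  exact_mod_cast this

theorem ex_zero (P : Ptn) : ex 0 P = ex 1 P + P.p 0 := by
  have h0 := ex_cast 0 P
  have h1 := ex_cast 1 P
  have e0 : P.headSum 0 = 0 := by simp [Ptn.headSum]
  have e1 : P.headSum 1 = P.p 0 := by simp [Ptn.headSum]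
  rw [e0] at h0; rw [e1] at h1
  have : (ex 0 P : ℤ) = ex 1 P + P.p 0 := by rw [h0, h1]; push_cast; ring
  exact_mod_cast this

def vP (q : ℂ) (l : ℕ) (P : Ptn) : ℂ := q ^ (ex l P) * (Ptn.bConj q P)⁻¹

theorem vP_zero (q : ℂ) (P : Ptn) : vP q 0 P = q ^ (P.p 0) * vP q 1 P := by
  rw [vP, vP, ex_zero, pow_add]; ring

theorem vP_succ (q : ℂ) (l : ℕ) (P : Ptn) :
    vP q (l + 1) P = fq q (P.p 0 - P.tl.p 0) * q ^ (2 * c2 (P.tl.p 0)) * vP q l P.tl := by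
  rw [vP, vP, ex_succ, Ptn.bConj_tl, pow_add, mul_inv, fq]; ring

/-- sum over first part `n`, weight `n+N`, by removing the first part -/
theorem sum_Fb (n N : ℕ) (f : Ptn → ℂ) :
    ∑ P ∈ Fb n (n + N), f P.tl = ∑ r ∈ range (n + 1), ∑ P ∈ Fb r N, f P := by
  classical
  have h : ∑ P ∈ Fb n (n + N), f P.tl = ∑ P ∈ (Ptn.finite_wt N).toFinset.filter (fun P => P.p 0 ≤ n), f P := by
    refine sum_bij (fun P _ => P.tl) ?_ ?_ ?_ ?_
    · intro P hP
      rw [mem_Fb] at hP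
      have h1 := P.wt_tl
      have h2 := P.tl_le
      simp; omega
    · intro P hP Q hQ h
      rw [mem_Fb] at hP hQ
      apply Ptn.ext'
      intro i
      rcases i with _ | i
      · omega
      · rw [← Ptn.tl_p, ← Ptn.tl_p, h]
    · intro P hP
      simp at hP
      refine ⟨Ptn.cns n P hP.2, ?_, Ptn.tl_cns _ _ _⟩
      rw [mem_Fb]
      refine ⟨Ptn.cns_zero _ _ _, ?_⟩
      rw [Ptn.wt_tl, Ptn.cns_zero, Ptn.tl_cns, hP.1]
    · intro P _; rfl
  rw [h, ← sum_fiberwise_of_maps_to (g := fun P : Ptn => P.p 0) (t := range (n + 1))]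
  · apply sum_congr rfl
    intro r hr
    apply sum_congr _ (fun _ _ => rfl)
    ext P
    simp only [mem_range] at hr
    rw [mem_Fb]
    simp; omega
  · intro P hP
    simp at hP ⊢; omega

def Ptn.zero : Ptn := ⟨0, by intro i j _; simp⟩

theorem Fb_zero (N : ℕ) (q : ℂ) (l : ℕ) : ∑ P ∈ Fb 0 N, vP q l P = if N = 0 then 1 else 0 := by
  have hz : ∀ P : Ptn, P.p 0 = 0 → P = Ptn.zero := by
    intro P h
    apply Ptn.ext'
    intro i
    have := P.mono (Nat.zero_le i)
    simp [Ptn.zero]; omega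
  have hw : Ptn.zero.wt = 0 := by simp [Ptn.zero, Ptn.wt]
  split_ifs with h
  · have : Fb 0 N = {Ptn.zero} := by
      ext P
      rw [mem_Fb, mem_singleton]
      constructor
      · rintro ⟨h1, _⟩; exact hz P h1
      · rintro rfl; exact ⟨by simp [Ptn.zero], by rw [hw, h]⟩
    rw [this, sum_singleton]
    have : ex l Ptn.zero = 0 := by simp [ex, Ptn.zero, Ptn.s2]
    rw [vP, this]
    simp [Ptn.bConj, Ptn.zero]
  · have : Fb 0 N = ∅ := by
      ext P
      rw [mem_Fb]
      simp only [notMem_empty, iff_false]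
      rintro ⟨h1, h2⟩
      rw [hz P h1, hw] at h2
      exact h h2.symm
    rw [this, sum_empty]

theorem fiber_sum {q : ℂ} (hq : ‖q‖ < 1) (N : ℕ) : ∀ l n,
    ∑ P ∈ Fb n (n + N), vP q l P = PowerSeries.coeff (2 * N) (Wn q l n) := by
  induction N using Nat.strong_induction_on with
  | _ N ih =>
    have main : ∀ l n, ∑ P ∈ Fb n (n + N), vP q (l + 1) P = PowerSeries.coeff (2 * N) (Wn q (l + 1) n) := by
      intro l n
      have e : ∀ P ∈ Fb n (n + N), vP q (l + 1) P =
          (fun Q : Ptn => fq q (n - Q.p 0) * q ^ (2 * c2 (Q.p 0)) * vP q l Q) P.tl := by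
        intro P hP
        rw [mem_Fb] at hP
        simp only [vP_succ, hP.1]
      rw [sum_congr rfl e, sum_Fb n N (fun Q : Ptn => fq q (n - Q.p 0) * q ^ (2 * c2 (Q.p 0)) * vP q l Q), ← Wn_rec hq, map_sum]
      apply sum_congr rfl
      intro r _
      have e2 : ∀ P ∈ Fb r N, fq q (n - P.p 0) * q ^ (2 * c2 (P.p 0)) * vP q l P =
          fq q (n - r) * q ^ (2 * c2 r) * vP q l P := by
        intro P hP
        rw [mem_Fb] at hP
        rw [hP.1]
      rw [sum_congr rfl e2, ← mul_sum, mul_assoc (PC _), PowerSeries.algebraMap_eq, PowerSeries.coeff_C_mul,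
        PowerSeries.coeff_X_pow_mul']
      congr 1
      rcases Nat.eq_zero_or_pos r with rfl | hr
      · rw [Fb_zero, Wn_n0]
        simp [PowerSeries.coeff_one]
      · split_ifs with h
        · have := ih (N - r) (by omega) l r
          rw [show r + (N - r) = N by omega] at this
          rw [this]; congr 2; omega
        · apply sum_eq_zero
          intro P hP
          rw [mem_Fb] at hP
          have := P.p_le_wt 0
          omega
    intro l n
    rcases l with _ | l
    · rw [Wn_zero, PowerSeries.algebraMap_eq, PowerSeries.coeff_C_mul, ← main 0 n, mul_sum]
      apply sum_congr rfl
      intro P hP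
      rw [mem_Fb] at hP
      rw [vP_zero, hP.1]
    · exact main l n

theorem bConj_ge {q : ℂ} (hq : ‖q‖ < 1) (P : Ptn) :
    ‖(Ptn.bConj q P)⁻¹‖ ≤ ‖(Ptn.bConj (‖q‖ : ℂ) P)⁻¹‖ := by
  have hr : ‖((‖q‖ : ℝ) : ℂ)‖ < 1 := by simpa using hq
  have h1 : ∀ n, ‖qP (‖q‖ : ℂ) (‖q‖ : ℂ) n‖ ≤ ‖qP q q n‖ := by
    intro n
    unfold qP
    rw [norm_prod, norm_prod]
    apply Finset.prod_le_prod
    · intro i _; exact norm_nonneg _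
    · intro i _
      have e : (1 - (‖q‖ : ℂ) * (‖q‖ : ℂ) ^ i) = ((1 - ‖q‖ * ‖q‖ ^ i : ℝ) : ℂ) := by push_cast; ring
      rw [e, Complex.norm_real, Real.norm_eq_abs, abs_of_nonneg]
      · have := norm_sub_norm_le (1 : ℂ) (q * q ^ i)
        rw [norm_one, norm_mul, norm_pow] at this
        exact this
      · have : ‖q‖ ^ (i + 1) ≤ 1 := pow_le_one₀ (norm_nonneg _) hq.le
        rw [pow_succ'] at this
        linarith
  rw [norm_inv, norm_inv]
  unfold Ptn.bConj
  rw [norm_prod, norm_prod]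
  apply inv_anti₀
  · apply prod_pos
    intro i _
    exact norm_pos_iff.mpr (qP_ne hr _)
  · apply Finset.prod_le_prod
    · intro i _; exact norm_nonneg _
    · intro i _; exact h1 _

theorem bConj_real {r : ℝ} (h0 : 0 ≤ r) (h1 : r < 1) (P : Ptn) :
    ((‖(Ptn.bConj (r : ℂ) P)⁻¹‖ : ℝ) : ℂ) = (Ptn.bConj (r : ℂ) P)⁻¹ := by
  have h : ∀ n, ((‖qP (r : ℂ) (r : ℂ) n‖ : ℝ) : ℂ) = qP (r : ℂ) (r : ℂ) n := by
    intro n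
    unfold qP
    rw [norm_prod]
    push_cast
    apply prod_congr rfl
    intro i _
    have e : (1 - (r : ℂ) * (r : ℂ) ^ i) = ((1 - r * r ^ i : ℝ) : ℂ) := by push_cast; ring
    rw [e, Complex.norm_real, Real.norm_eq_abs, abs_of_nonneg]
    have : r ^ (i + 1) ≤ 1 := pow_le_one₀ h0 h1.le
    rw [pow_succ'] at this
    linarith
  rw [norm_inv]
  push_cast
  congr 1
  unfold Ptn.bConj
  rw [norm_prod]
  push_cast
  exact prod_congr rfl (fun i _ => h _)

theorem fiber_norm {q : ℂ} (hq : ‖q‖ < 1) (l : ℕ) :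
    ∃ M : ℝ, 1 ≤ M ∧ ∀ n N, ∑ P ∈ Fb n (n + N), ‖vP q l P‖ ≤ M := by
  have hr : ‖((‖q‖ : ℝ) : ℂ)‖ < 1 := by simpa using hq
  obtain ⟨M, h1, hM⟩ := Wn_bdd hr l
  refine ⟨M, h1, fun n N => ?_⟩
  refine le_trans ?_ (hM n (2 * N))
  rw [← fiber_sum hr]
  have : ∑ P ∈ Fb n (n + N), vP (‖q‖ : ℂ) l P =
     ((∑ P ∈ Fb n (n + N), ‖q‖ ^ (ex l P) * ‖(Ptn.bConj (‖q‖ : ℂ) P)⁻¹‖ : ℝ) : ℂ) := by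
    push_cast
    apply sum_congr rfl
    intro P _
    rw [vP]
    congr 1
    exact (bConj_real (norm_nonneg _) hq P).symm
  rw [this, Complex.norm_real, Real.norm_eq_abs]
  refine le_trans ?_ (le_abs_self _)
  apply sum_le_sum
  intro P _
  rw [vP, norm_mul, norm_pow]
  gcongr
  exact bConj_ge hq P

def hq0 (q : ℂ) (t : ℤ) : ℂ := if 0 ≤ t then q ^ (c2 (t + 1)) * fq q t.toNat else 0

def Aq (q : ℂ) (n : ℕ) (k : ℤ) : ℂ :=
  if 0 ≤ k + n then q ^ (c2 (k + 1)) * fq q (k + n).toNat else 0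

theorem c2_shift {k : ℤ} {n : ℕ} (h : 0 ≤ k + n + 1) :
    n + c2 (k + 1 + 1) = c2 (k + 1) + (k + n + 1).toNat := by
  have h1 := c2_two (k + 1 + 1)
  have h2 := c2_two (k + 1)
  have h3 := Int.toNat_of_nonneg h
  zify
  rw [h3]
  linarith

theorem Aq_rec {q : ℂ} (hq : ‖q‖ < 1) (n : ℕ) (k : ℤ) :
    Aq q (n + 1) k = Aq q n k + q ^ n * Aq q n (k + 1) := by
  unfold Aq
  push_cast
  have e : k + 1 + (n : ℤ) = k + n + 1 := by ring
  have e' : k + ((n : ℤ) + 1) = k + n + 1 := by ring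
  rw [e, e']
  by_cases h : 0 ≤ k + (n : ℤ) + 1
  · simp only [h, if_true]
    have hs := c2_shift h
    have hp : q ^ n * (q ^ c2 (k + 1 + 1) * fq q (k + n + 1).toNat) =
       q ^ (c2 (k + 1)) * q ^ ((k + n + 1).toNat) * fq q (k + n + 1).toNat := by
      rw [← mul_assoc, ← pow_add, hs, pow_add]
    rw [hp]
    by_cases h0 : 0 ≤ k + (n : ℤ)
    · simp only [h0, if_true]
      obtain ⟨a, ha⟩ := Int.eq_ofNat_of_zero_le h0
      have e1 : (k + (n : ℤ)).toNat = a := by omega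
      have e2 : (k + (n : ℤ) + 1).toNat = a + 1 := by omega
      rw [e1, e2, ← fq_succ hq a]
      ring
    · simp only [h0, if_false]
      have e2 : (k + (n : ℤ) + 1).toNat = 0 := by omega
      rw [e2]; simp
  · have h0 : ¬ 0 ≤ k + (n : ℤ) := by omega
    simp [h, h0]

theorem zc_rec {q : ℂ} (hq : ‖q‖ < 1) {n u : ℕ} (h : u ≤ n) :
    PowerSeries.coeff (u + 1) (Zn q (n + 1)) =
      PowerSeries.coeff (u + 1) (Zn q n) + q ^ n * PowerSeries.coeff u (Zn q n) := by
  rw [coeff_Zn hq, coeff_Zn hq, coeff_Zn hq, gb_pascal hq h, c2_succ, pow_add]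
  have : q ^ n = q ^ u * q ^ (n - u) := by rw [← pow_add]; congr 1; omega
  rw [this]; ring

theorem Aq_sum {q : ℂ} (hq : ‖q‖ < 1) (n : ℕ) : ∀ k : ℤ,
    ∑ u ∈ range (n + 1), hq0 q (k + u) * PowerSeries.coeff u (Zn q n) = Aq q n k := by
  induction n with
  | zero => intro k; simp [hq0, Aq, Zn]
  | succ n ih =>
    intro k
    rw [Aq_rec hq, ← ih k, ← ih (k + 1), sum_range_succ']
    have e : ∀ u ∈ range (n + 1), hq0 q (k + ((u + 1 : ℕ) : ℤ)) * PowerSeries.coeff (u + 1) (Zn q (n + 1)) =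
       hq0 q (k + ((u + 1 : ℕ) : ℤ)) * PowerSeries.coeff (u + 1) (Zn q n) +
       q ^ n * (hq0 q (k + 1 + u) * PowerSeries.coeff u (Zn q n)) := by
      intro u hu
      have hu' : u ≤ n := by simpa [Nat.lt_succ_iff] using hu
      rw [zc_rec hq hu']
      push_cast
      rw [show k + ((u : ℤ) + 1) = k + 1 + u by ring]
      ring
    rw [sum_congr rfl e, sum_add_distrib, ← mul_sum]
    have z : PowerSeries.coeff (n + 1) (Zn q n) = 0 := by
      rw [coeff_Zn hq, gb_of_lt (Nat.lt_succ_self n), mul_zero]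
    have s : ∑ u ∈ range (n + 1), hq0 q (k + u) * PowerSeries.coeff u (Zn q n) =
      ∑ u ∈ range (n + 1 + 1), hq0 q (k + u) * PowerSeries.coeff u (Zn q n) := by
      rw [sum_range_succ _ (n + 1), z, mul_zero, add_zero]
    rw [s, sum_range_succ' _ (n + 1)]
    have z0 : PowerSeries.coeff 0 (Zn q (n + 1)) = PowerSeries.coeff 0 (Zn q n) := by
      rw [coeff_Zn hq, coeff_Zn hq, gb_zero hq, gb_zero hq]
    rw [z0]
    ring

theorem summable_c2_nat {r : ℝ} (h0 : 0 ≤ r) (h1 : r < 1) : Summable (fun n : ℕ => r ^ (c2 (n : ℤ))) := by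
  rw [← summable_nat_add_iff 1]
  refine Summable.of_nonneg_of_le (fun n => by positivity) (fun n => ?_) (summable_geometric_of_lt_one h0 h1)
  rw [c2_succ]
  exact pow_le_pow_of_le_one h0 h1.le (by omega)

theorem summable_c2_int {r : ℝ} (h0 : 0 ≤ r) (h1 : r < 1) : Summable (fun k : ℤ => r ^ (c2 k)) := by
  refine Summable.of_nat_of_neg (f := fun k : ℤ => r ^ (c2 k)) ?_ ?_
  · exact summable_c2_nat h0 h1
  refine Summable.of_nonneg_of_le (fun n => by positivity) (fun n => ?_) (summable_geometric_of_lt_one h0 h1)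
  apply pow_le_pow_of_le_one h0 h1.le
  have := c2_two (-(n : ℤ))
  zify
  have h2 : (0 : ℤ) ≤ n * (n - 1) := by
    rcases n with _ | n
    · simp
    · push_cast
      have : (n : ℤ) + 1 - 1 = n := by ring
      rw [this]
      positivity
  linarith

theorem hq0_bdd {q : ℂ} (hq : ‖q‖ < 1) : ∃ M : ℝ, 1 ≤ M ∧ ∀ t, ‖hq0 q t‖ ≤ M * ‖q‖ ^ (c2 (t + 1)) := by
  obtain ⟨M, h1, hP, hf⟩ := q_bdd hq
  refine ⟨M, h1, fun t => ?_⟩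
  unfold hq0
  split_ifs
  · rw [norm_mul, norm_pow, mul_comm]
    gcongr
    exact hf _
  · rw [norm_zero]; positivity

theorem Aq_bdd {q : ℂ} (hq : ‖q‖ < 1) :
    ∃ M : ℝ, 1 ≤ M ∧ ∀ n k, ‖Aq q n k‖ ≤ M * ‖q‖ ^ (c2 (k + 1)) := by
  obtain ⟨M, h1, hP, hf⟩ := q_bdd hq
  refine ⟨M, h1, fun n k => ?_⟩
  unfold Aq
  split_ifs
  · rw [norm_mul, norm_pow, mul_comm]
    gcongr
    exact hf _
  · rw [norm_zero]; positivity

/-- regrouping along fibres -/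
def fibEquiv {α β : Type*} (π : α → β) (F : β → Finset α) (hF : ∀ a b, a ∈ F b ↔ π a = b) :
    (Σ b, {a // a ∈ F b}) ≃ α where
  toFun x := x.2.1
  invFun a := ⟨π a, a, (hF a _).2 rfl⟩
  left_inv := by
    rintro ⟨b, a, h⟩
    have := (hF a b).1 h
    subst this
    rfl
  right_inv a := rfl

theorem fib_hasSum {α β : Type*} {f : α → ℂ} (π : α → β) (F : β → Finset α)
    (hF : ∀ a b, a ∈ F b ↔ π a = b) (hf : Summable f) :
    HasSum (fun b => ∑ a ∈ F b, f a) (∑' a, f a) := by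
  have h := ((fibEquiv π F hF).hasSum_iff (f := f)).2 hf.hasSum
  refine h.sigma (fun b => ?_)
  have := Finset.hasSum (F b) f
  exact this

theorem fib_summable {α β : Type*} {f : α → ℂ} (π : α → β) (F : β → Finset α)
    (hF : ∀ a b, a ∈ F b ↔ π a = b) {g : β → ℝ} (hg : Summable g)
    (hb : ∀ b, ∑ a ∈ F b, ‖f a‖ ≤ g b) : Summable f := by
  apply Summable.of_norm
  rw [← (fibEquiv π F hF).summable_iff]
  refine (summable_sigma_of_nonneg (f := fun x => ‖f (fibEquiv π F hF x)‖)
    (fun x => norm_nonneg _)).2 ⟨fun b => (Finset.hasSum (F b) (fun a => ‖f a‖)).summable, ?_⟩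
  refine Summable.of_nonneg_of_le (fun b => tsum_nonneg fun _ => norm_nonneg _) (fun b => ?_) hg
  have := (Finset.hasSum (F b) (fun a => ‖f a‖)).tsum_eq
  refine le_trans (le_of_eq ?_) (hb b)
  exact this

theorem prod_shift {q : ℂ} (hq : ‖q‖ < 1) (k n : ℕ) :
    ∏ c ∈ range n, (1 - q ^ (k + 1) * q ^ c)⁻¹ = qP q q k * fq q (n + k) := by
  induction n with
  | zero => simp [fq, mul_inv_cancel₀ (qP_ne hq k)]
  | succ n ih =>
    rw [prod_range_succ, ih, show n + 1 + k = (n + k) + 1 by ring, ← fq_succ hq (n + k),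
      show q ^ (k + 1) * q ^ n = q ^ (n + k + 1) by ring]
    have := one_sub_pow_ne hq (n + k)
    field_simp

theorem JT_fin {q : ℂ} (hq : ‖q‖ < 1) (k N : ℕ) :
    ∑ n ∈ range (N + 1), gb q N n * q ^ (n * n + n * k) * fq q (n + k) = fq q (N + k) := by
  have h := Tlem (R := ℂ) hq N (q ^ (k + 1)) (fun c => (1 - q ^ (k + 1) * q ^ c)⁻¹) (fun c => by
    apply inv_mul_cancel₀
    have := one_sub_pow_ne hq (k + c)
    rw [show q ^ (k + 1) * q ^ c = q ^ (k + c + 1) by ring]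
    exact this)
  simp only [prod_shift hq, Algebra.algebraMap_self, RingHom.id_apply] at h
  apply mul_left_cancel₀ (qP_ne hq k)
  rw [← h, mul_sum]
  apply sum_congr rfl
  intro n _
  have : q ^ (n * n + n * k) = q ^ (2 * c2 n) * (q ^ (k + 1)) ^ n := by
    rw [← pow_mul, ← pow_add]
    congr 1
    have := c2_two n
    zify
    rw [this]; ring
  rw [this]; ring

theorem summable_JT {r : ℝ} (h0 : 0 ≤ r) (h1 : r < 1) (k : ℕ) :
    Summable (fun t : ℕ => r ^ (t * t + t * k)) := by
  refine Summable.of_nonneg_of_le (fun n => by positivity) (fun n => ?_) (summable_geometric_of_lt_one h0 h1)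
  apply pow_le_pow_of_le_one h0 h1.le
  nlinarith [Nat.le_mul_self n]

theorem JT {q : ℂ} (hq : ‖q‖ < 1) (k : ℕ) :
    HasSum (fun t : ℕ => fq q t * q ^ (t * t + t * k) * fq q (t + k)) (qPInf q q)⁻¹ := by
  obtain ⟨M, h1, hP, hf⟩ := q_bdd hq
  obtain ⟨B, hB1, hB⟩ := gb_bdd hq
  have hs : Summable (fun t : ℕ => fq q t * q ^ (t * t + t * k) * fq q (t + k)) := by
    refine Summable.of_norm_bounded ((summable_JT (norm_nonneg q) hq k).mul_left (M * M)) (fun t => ?_)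
    rw [norm_mul, norm_mul, norm_pow]
    calc ‖fq q t‖ * ‖q‖ ^ (t * t + t * k) * ‖fq q (t + k)‖ ≤ M * ‖q‖ ^ (t * t + t * k) * M := by
          gcongr
          · exact hf _
          · exact hf _
      _ = _ := by ring
  have hT := tendsto_tsum_of_dominated_convergence (𝓕 := atTop)
    (f := fun N t => gb q N t * q ^ (t * t + t * k) * fq q (t + k))
    (g := fun t : ℕ => fq q t * q ^ (t * t + t * k) * fq q (t + k))
    ((summable_JT (norm_nonneg q) hq k).mul_left (B * M))
    (fun t => ((gb_tendsto hq t).mul_const _).mul_const _)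
    (Eventually.of_forall fun N t => by
      rw [norm_mul, norm_mul, norm_pow]
      calc ‖gb q N t‖ * ‖q‖ ^ (t * t + t * k) * ‖fq q (t + k)‖ ≤ B * ‖q‖ ^ (t * t + t * k) * M := by
            gcongr
            · exact hB _ _
            · exact hf _
        _ = _ := by ring)
  have hE : ∀ N, ∑' t, gb q N t * q ^ (t * t + t * k) * fq q (t + k) = fq q (N + k) := by
    intro N
    rw [← JT_fin hq k N]
    apply tsum_eq_sum
    intro t ht
    rw [gb_of_lt (by simpa using ht)]; ring
  simp only [hE] at hT
  have hT2 := (fq_tendsto hq).comp (tendsto_add_atTop_nat k)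
  have := tendsto_nhds_unique hT hT2
  rw [← this]
  exact hs.hasSum

theorem _root_.HasSum.congr_fun' {α : Type*} {f g : α → ℂ} {a : ℂ} (h : HasSum f a) (e : g = f) :
    HasSum g a := by rw [e]; exact h

theorem JT2 {q : ℂ} (hq : ‖q‖ < 1) (k : ℤ) :
    HasSum (fun s : ℕ => hq0 q (s - k) * (q ^ (c2 s) * fq q s)) ((qPInf q q)⁻¹ * q ^ (c2 k)) := by
  rcases Int.le_total 0 k with hk | hk
  · obtain ⟨a, rfl⟩ := Int.eq_ofNat_of_zero_le hk
    have h := (JT hq a).mul_right (q ^ (c2 (a : ℤ)))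
    rw [← Function.Injective.hasSum_iff (add_left_injective a)]
    · refine h.congr_fun' ?_
      funext t
      simp only [Function.comp, hq0]
      have e1 : (((t + a : ℕ) : ℤ) - a) = t := by push_cast; ring
      rw [e1, if_pos (by omega), Int.toNat_natCast]
      have e2 : c2 ((t : ℤ) + 1) + c2 ((t + a : ℕ) : ℤ) = t * t + t * a + c2 (a : ℤ) := by
        have h1 := c2_two ((t : ℤ) + 1)
        have h2 := c2_two ((t + a : ℕ) : ℤ)
        have h3 := c2_two (a : ℤ)
        push_cast at h2
        zify
        linarith
      calc _ = (q ^ c2 ((t : ℤ) + 1) * q ^ c2 ((t + a : ℕ) : ℤ)) * (fq q t * fq q (t + a)) := by ring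
        _ = _ := by rw [← pow_add, e2, pow_add]; ring
    · intro s hs
      have : s < a := by
        by_contra hc
        exact hs ⟨s - a, by simp; omega⟩
      simp only [hq0]
      rw [if_neg (by omega), zero_mul]
  · obtain ⟨a, ha⟩ := Int.eq_ofNat_of_zero_le (show 0 ≤ -k by omega)
    obtain rfl : k = -(a : ℤ) := by omega
    have h := (JT hq a).mul_right (q ^ (c2 (-(a : ℤ))))
    refine h.congr_fun' ?_
    · funext t
      simp only [hq0]
      have e1 : ((t : ℤ) - -(a : ℤ)) = ((t + a : ℕ) : ℤ) := by push_cast; ring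
      rw [e1, if_pos (by omega), Int.toNat_natCast]
      have e2 : c2 (((t + a : ℕ) : ℤ) + 1) + c2 (t : ℤ) = t * t + t * a + c2 (-(a : ℤ)) := by
        have h1 := c2_two (t : ℤ)
        have h2 := c2_two (((t + a : ℕ) : ℤ) + 1)
        have h3 := c2_two (-(a : ℤ))
        push_cast at h2
        zify
        linarith
      calc _ = (q ^ c2 (((t + a : ℕ) : ℤ) + 1) * q ^ c2 (t : ℤ)) * (fq q t * fq q (t + a)) := by ring
        _ = _ := by rw [← pow_add, e2, pow_add]; ring

theorem summable_S2 {r : ℝ} (h0 : 0 ≤ r) (h1 : r < 1) :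
    Summable (fun x : ℕ × ℤ => r ^ (c2 (x.1 : ℤ)) * r ^ (c2 x.2)) :=
  Summable.mul_of_nonneg (f := fun n : ℕ => r ^ (c2 (n : ℤ))) (g := fun k : ℤ => r ^ (c2 k))
    (summable_c2_nat h0 h1) (summable_c2_int h0 h1)
    (fun _ => pow_nonneg h0 _) (fun _ => pow_nonneg h0 _)

theorem summable_S3 {r : ℝ} (h0 : 0 ≤ r) (h1 : r < 1) :
    Summable (fun x : ℕ × (ℕ × ℤ) => r ^ (c2 (x.1 : ℤ)) * (r ^ (c2 (x.2.1 : ℤ)) * r ^ (c2 x.2.2))) :=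
  Summable.mul_of_nonneg (f := fun n : ℕ => r ^ (c2 (n : ℤ)))
    (g := fun x : ℕ × ℤ => r ^ (c2 (x.1 : ℤ)) * r ^ (c2 x.2))
    (summable_c2_nat h0 h1) (summable_S2 h0 h1)
    (fun _ => pow_nonneg h0 _) (fun _ => mul_nonneg (pow_nonneg h0 _) (pow_nonneg h0 _))

theorem E2_bdd {q : ℂ} (hq : ‖q‖ < 1) : ∃ M : ℝ, 1 ≤ M ∧ ∀ p, ‖PowerSeries.coeff p (E2 q)‖ ≤ M := by
  obtain ⟨M, h1, hP, hf⟩ := q_bdd hq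
  refine ⟨M, h1, fun p => ?_⟩
  simp only [E2, PowerSeries.coeff_mk]
  split_ifs
  · exact hf _
  · rw [norm_zero]; linarith

def Bq (q : ℂ) (j : ℤ) : ℂ := (qPInf q q)⁻¹ * ∑' i : ℕ, q ^ (c2 (j - 2 * i)) * fq q i

theorem eK_hasSum {q : ℂ} (hq : ‖q‖ < 1) (j : ℤ) :
    HasSum (fun K : ℕ => hq0 q (K - j) * eK q K) (Bq q j) := by
  obtain ⟨M, h1, hP, hf⟩ := q_bdd hq
  obtain ⟨A, hA1, hA⟩ := hq0_bdd hq
  obtain ⟨B, hB1, hB⟩ := E2_bdd hq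
  set f : ℕ × ℕ → ℂ := fun x => PowerSeries.coeff x.1 (E2 q) *
    (hq0 q (x.2 - (j - x.1)) * (q ^ (c2 (x.2 : ℤ)) * fq q x.2)) with hfdef
  have hsum : Summable f := by
    have hinj : Function.Injective (fun x : ℕ × ℕ => ((x.2, (x.2 : ℤ) - (j - x.1) + 1) : ℕ × ℤ)) := by
      rintro ⟨a, b⟩ ⟨c, d⟩ h
      simp only [Prod.mk.injEq] at h ⊢
      omega
    refine Summable.of_norm_bounded
      (((summable_S2 (norm_nonneg q) hq).comp_injective hinj).mul_left (B * A * M)) ?_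
    rintro ⟨p, u⟩
    simp only [hfdef, Function.comp, norm_mul, norm_pow]
    calc _ ≤ B * ((A * ‖q‖ ^ (c2 ((u : ℤ) - (j - p) + 1))) * (‖q‖ ^ (c2 (u : ℤ)) * M)) := by
          gcongr
          · exact hB _
          · exact hA _
          · exact hf _
      _ = _ := by ring
  have key := fib_hasSum (fun x : ℕ × ℕ => x.1 + x.2) (fun K => antidiagonal K)
    (fun a b => mem_antidiagonal) hsum
  have e1 : (fun K => ∑ a ∈ antidiagonal K, f a) = fun K : ℕ => hq0 q (K - j) * eK q K := by
    funext K
    unfold eK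
    rw [mul_comm (E1 q), PowerSeries.coeff_mul, mul_sum]
    apply sum_congr rfl
    rintro ⟨p, u⟩ hx
    have hx' : p + u = K := by simpa using hx
    subst hx'
    simp only [hfdef, E1, PowerSeries.coeff_mk]
    rw [show ((p + u : ℕ) : ℤ) - j = u - (j - p) by push_cast; ring]
    ring
  rw [e1] at key
  have e2 : ∑' x, f x = Bq q j := by
    rw [hsum.tsum_prod]
    have : ∀ p : ℕ, ∑' u : ℕ, f (p, u) =
        (qPInf q q)⁻¹ * (PowerSeries.coeff p (E2 q) * q ^ (c2 (j - p))) := by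
      intro p
      simp only [hfdef]
      rw [tsum_mul_left, (JT2 hq (j - p)).tsum_eq]
      ring
    simp only [this]
    rw [tsum_mul_left]
    unfold Bq
    congr 1
    rw [← Function.Injective.tsum_eq (g := fun i : ℕ => 2 * i)
      (fun a b h => by simpa using h)]
    · apply tsum_congr
      intro i
      simp [E2, mul_comm]
    · intro p hp
      by_contra hc
      apply hp
      have : ¬ Even p := fun ⟨a, ha⟩ => hc ⟨a, by simp; omega⟩
      simp [E2, this]
  rw [← e2]
  exact key

theorem eK_shift {q : ℂ} (hq : ‖q‖ < 1) (j : ℤ) (l : ℕ) :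
    HasSum (fun K : ℕ => hq0 q (K - j) * if 2 * l + 1 ≤ K then eK q (K - (2 * l + 1)) else 0)
      (Bq q (j - 2 * l - 1)) := by
  rw [← Function.Injective.hasSum_iff (add_left_injective (2 * l + 1))]
  · refine (eK_hasSum hq (j - 2 * l - 1)).congr_fun' ?_
    funext K
    simp only [Function.comp]
    rw [if_pos (by omega), Nat.add_sub_cancel]
    congr 2
    push_cast
    ring
  · intro s hs
    have : ¬ (2 * l + 1 ≤ s) := by
      intro hc
      exact hs ⟨s - (2 * l + 1), by simp; omega⟩
    rw [if_neg this, mul_zero]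

theorem Bq_summable {q : ℂ} (hq : ‖q‖ < 1) (j : ℤ) :
    Summable (fun i : ℕ => q ^ (c2 (j - 2 * i)) * fq q i) := by
  obtain ⟨M, h1, hP, hf⟩ := q_bdd hq
  have hinj : Function.Injective (fun i : ℕ => j - 2 * (i : ℤ)) := by
    intro a b h
    simp only at h
    omega
  refine Summable.of_norm_bounded
    (((summable_c2_int (norm_nonneg q) hq).comp_injective hinj).mul_left M) ?_
  intro i
  rw [norm_mul, norm_pow, mul_comm]
  simp only [Function.comp]
  gcongr
  exact hf _

theorem rhs_eq {q : ℂ} (hq : ‖q‖ < 1) (j : ℤ) (l : ℕ) :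
    (qPInf q q)⁻¹ *
        ∑' i : ℕ,
          (q ^ (ch2 (j - 2 * (i : ℤ))) - q ^ (ch2 (j - 2 * (i : ℤ) - 2 * (l : ℤ) - 1))) *
            (qP q q i)⁻¹ = Bq q j - Bq q (j - 2 * l - 1) := by
  unfold Bq
  rw [← mul_sub, ← (Bq_summable hq j).tsum_sub (Bq_summable hq _)]
  congr 1
  apply tsum_congr
  intro i
  rw [zpow_ch2, zpow_ch2, show j - 2 * (l : ℤ) - 1 - 2 * i = j - 2 * (i : ℤ) - 2 * (l : ℤ) - 1 by ring]
  unfold fq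
  ring

/-- triple-sum term -/
def T3 (q : ℂ) (l : ℕ) (j : ℤ) (x : (ℕ × ℕ) × ℕ) : ℂ :=
  q ^ (c2 (x.1.1 : ℤ)) * PowerSeries.coeff x.1.2 (Wn q l x.1.1) *
    (hq0 q ((x.1.1 : ℤ) + x.1.2 - j + x.2) * PowerSeries.coeff x.2 (Zn q x.1.1))

theorem T3_summable {q : ℂ} (hq : ‖q‖ < 1) (j : ℤ) (l : ℕ) : Summable (T3 q l j) := by
  obtain ⟨A, hA1, hA⟩ := hq0_bdd hq
  obtain ⟨B, hB1, hB⟩ := Wn_bdd hq l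
  obtain ⟨G, hG1, hG⟩ := gb_bdd hq
  have hinj : Function.Injective (fun x : (ℕ × ℕ) × ℕ =>
      ((x.1.1, (x.2, (x.1.1 : ℤ) + x.1.2 - j + x.2 + 1)) : ℕ × (ℕ × ℤ))) := by
    rintro ⟨⟨a, b⟩, e⟩ ⟨⟨c, d⟩, f⟩ h
    simp only [Prod.mk.injEq] at h ⊢
    omega
  refine Summable.of_norm_bounded
    (((summable_S3 (norm_nonneg q) hq).comp_injective hinj).mul_left (B * A * G)) ?_
  rintro ⟨⟨n, p⟩, u⟩
  simp only [T3, Function.comp]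
  rw [coeff_Zn hq]
  simp only [norm_mul, norm_pow]
  calc _ ≤ ‖q‖ ^ (c2 (n : ℤ)) * B *
        ((A * ‖q‖ ^ (c2 ((n : ℤ) + p - j + u + 1))) * (‖q‖ ^ (c2 (u : ℤ)) * G)) := by
        gcongr
        · exact hB _ _
        · exact hA _
        · exact hG _ _
    _ = _ := by ring

def swp (x : (Σ _ : ℕ, ℕ × ℕ)) : (ℕ × ℕ) × ℕ := ((x.1, x.2.2), x.2.1)

theorem swp_inj : Function.Injective swp := by
  rintro ⟨a, b, c⟩ ⟨d, e, f⟩ h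
  simp only [swp, Prod.mk.injEq] at h
  obtain ⟨⟨rfl, rfl⟩, rfl⟩ := h
  rfl

def FK (K : ℕ) : Finset ((ℕ × ℕ) × ℕ) :=
  ((range (K + 1)).sigma fun n => antidiagonal (K - n)).map ⟨swp, swp_inj⟩

theorem mem_FK (a : (ℕ × ℕ) × ℕ) (K : ℕ) : a ∈ FK K ↔ a.1.1 + a.1.2 + a.2 = K := by
  obtain ⟨⟨n, p⟩, u⟩ := a
  simp only [FK, Finset.mem_map, mem_sigma, mem_range, HasAntidiagonal.mem_antidiagonal,
    Function.Embedding.coeFn_mk]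
  constructor
  · rintro ⟨⟨a, b, c⟩, ⟨h1, h2⟩, h⟩
    simp only [swp, Prod.mk.injEq] at h h1 h2
    omega
  · intro h
    exact ⟨⟨n, u, p⟩, ⟨by simp only; omega, by simp only; omega⟩, rfl⟩

theorem T3_fib {q : ℂ} (hq : ‖q‖ < 1) (j : ℤ) (l K : ℕ) :
    ∑ a ∈ FK K, T3 q l j a =
      hq0 q (K - j) * (eK q K - if 2 * l + 1 ≤ K then eK q (K - (2 * l + 1)) else 0) := by
  rw [← phi hq l K, FK, sum_map, sum_sigma, mul_sum]
  apply sum_congr rfl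
  intro n hn
  have hn' : n ≤ K := by simpa [Nat.lt_succ_iff] using hn
  rw [PowerSeries.coeff_X_pow_mul', if_pos hn', mul_assoc,
    show PC (q ^ (c2 (n : ℤ))) = PowerSeries.C (q ^ (c2 (n : ℤ))) from rfl,
    PowerSeries.coeff_C_mul, PowerSeries.coeff_mul, mul_sum, mul_sum]
  apply sum_congr rfl
  rintro ⟨u, p⟩ hx
  have hx' : u + p = K - n := by simpa using hx
  simp only [T3, swp, Function.Embedding.coeFn_mk]
  rw [show (n : ℤ) + p - j + u = K - j by omega]
  ring

theorem T3_tsum {q : ℂ} (hq : ‖q‖ < 1) (j : ℤ) (l : ℕ) :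
    ∑' x, T3 q l j x = Bq q j - Bq q (j - 2 * l - 1) := by
  have h1 := fib_hasSum (fun x : (ℕ × ℕ) × ℕ => x.1.1 + x.1.2 + x.2) FK mem_FK (T3_summable hq j l)
  simp only [T3_fib hq] at h1
  have h2 := (eK_hasSum hq j).sub (eK_shift hq j l)
  simp only [← mul_sub] at h2
  exact h1.unique h2

/-- double-sum term -/
def T2 (q : ℂ) (l : ℕ) (j : ℤ) (x : ℕ × ℕ) : ℂ :=
  q ^ (c2 (x.1 : ℤ)) * PowerSeries.coeff x.2 (Wn q l x.1) * Aq q x.1 ((x.1 : ℤ) + x.2 - j)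

theorem T2_tsum {q : ℂ} (hq : ‖q‖ < 1) (j : ℤ) (l : ℕ) :
    ∑' x, T2 q l j x = Bq q j - Bq q (j - 2 * l - 1) := by
  rw [← T3_tsum hq, (T3_summable hq j l).tsum_prod]
  apply tsum_congr
  rintro ⟨n, p⟩
  simp only [T2, T3]
  rw [tsum_mul_left, ← Aq_sum hq]
  congr 1
  symm
  apply tsum_eq_sum
  intro u hu
  rw [coeff_Zn hq, gb_of_lt (by simpa using hu)]
  ring

theorem T2_even {q : ℂ} (hq : ‖q‖ < 1) (j : ℤ) (l : ℕ) :
    ∑' x : ℕ × ℕ, T2 q l j (x.1, 2 * x.2) = Bq q j - Bq q (j - 2 * l - 1) := by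
  rw [← T2_tsum hq]
  have hinj : Function.Injective (fun x : ℕ × ℕ => ((x.1, 2 * x.2) : ℕ × ℕ)) := by
    rintro ⟨a, b⟩ ⟨c, d⟩ h
    simp only [Prod.mk.injEq] at h ⊢
    omega
  refine hinj.tsum_eq (f := T2 q l j) ?_
  rintro ⟨n, p⟩ hp
  by_contra hc
  apply hp
  have : ¬ Even p := fun ⟨a, ha⟩ => hc ⟨(n, a), by simp; omega⟩
  simp only [T2]
  rw [Wn_odd hq l n p this]
  ring

/-- term over partitions -/
def TP (q : ℂ) (l : ℕ) (j : ℤ) (P : Ptn) : ℂ :=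
  q ^ (c2 (P.p 0 : ℤ)) * Aq q (P.p 0) (2 * (P.wt : ℤ) - P.p 0 - j) * vP q l P

theorem TP_tsum {q : ℂ} (hq : ‖q‖ < 1) (j : ℤ) (l : ℕ) :
    ∑' P, TP q l j P = Bq q j - Bq q (j - 2 * l - 1) := by
  obtain ⟨A, hA1, hA⟩ := Aq_bdd hq
  obtain ⟨V, hV1, hV⟩ := fiber_norm hq l
  have hF : ∀ (P : Ptn) (b : ℕ × ℕ), P ∈ Fb b.1 (b.1 + b.2) ↔ (P.p 0, P.wt - P.p 0) = b := by
    rintro P ⟨n, N⟩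
    have := P.p_le_wt
    rw [mem_Fb, Prod.mk.injEq]
    have h0 := P.p_le_wt 0
    omega
  have hT : ∀ (n N : ℕ), ∀ P ∈ Fb n (n + N), TP q l j P =
      q ^ (c2 (n : ℤ)) * Aq q n ((n : ℤ) + 2 * N - j) * vP q l P := by
    intro n N P hP
    rw [mem_Fb] at hP
    unfold TP
    rw [hP.1, hP.2]
    congr 3
    push_cast
    ring
  have hinj : Function.Injective (fun x : ℕ × ℕ =>
      ((x.1, (x.1 : ℤ) + 2 * x.2 - j + 1) : ℕ × ℤ)) := by
    rintro ⟨a, b⟩ ⟨c, d⟩ h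
    simp only [Prod.mk.injEq] at h ⊢
    omega
  have hs : Summable (TP q l j) := by
    refine fib_summable (fun P : Ptn => (P.p 0, P.wt - P.p 0)) (fun b => Fb b.1 (b.1 + b.2)) hF
      (((summable_S2 (norm_nonneg q) hq).comp_injective hinj).mul_left (A * V)) ?_
    rintro ⟨n, N⟩
    simp only [Function.comp]
    rw [sum_congr rfl (fun P hP => by rw [hT n N P hP, norm_mul, norm_mul, norm_pow]), ← mul_sum]
    calc _ ≤ ‖q‖ ^ (c2 (n : ℤ)) * (A * ‖q‖ ^ (c2 ((n : ℤ) + 2 * N - j + 1))) * V := by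
          gcongr
          · exact hA _ _
          · exact hV _ _
      _ = _ := by ring
  have h := fib_hasSum (fun P : Ptn => (P.p 0, P.wt - P.p 0)) (fun b => Fb b.1 (b.1 + b.2)) hF hs
  rw [← h.tsum_eq, ← T2_even hq]
  apply tsum_congr
  rintro ⟨n, N⟩
  simp only [T2]
  rw [sum_congr rfl (hT n N), ← mul_sum, fiber_sum hq]
  push_cast
  ring

theorem lhs_term {q : ℂ} (j : ℤ) (l : ℕ) (P : Ptn) (m : ℕ) (h : 2 * (P.wt : ℤ) = j + m) :
    q ^ (ch2 ((m : ℤ) + 1) - (m : ℤ) * (P.p 0 : ℤ) + 2 * (P.nConj : ℤ)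
            + (P.wt : ℤ) - (P.headSum l : ℤ)) *
          ((qP q q m)⁻¹ * (Ptn.bConj q P)⁻¹) = TP q l j P := by
  have e : ch2 ((m : ℤ) + 1) - (m : ℤ) * (P.p 0 : ℤ) + 2 * (P.nConj : ℤ)
            + (P.wt : ℤ) - (P.headSum l : ℤ) =
      ((c2 (P.p 0 : ℤ) + c2 ((m : ℤ) - P.p 0 + 1) + ex l P : ℕ) : ℤ) := by
    have h1 := ch2_two ((m : ℤ) + 1)
    have h2 := c2_two (P.p 0 : ℤ)
    have h3 := c2_two ((m : ℤ) - P.p 0 + 1)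
    have h4 := ex_cast l P
    have h5 := P.nConj_eq
    have h5' : 2 * (P.nConj : ℤ) + P.wt = P.s2 := by exact_mod_cast h5
    push_cast
    rw [h4]
    linarith
  rw [e, zpow_natCast]
  unfold TP Aq vP
  have e1 : 2 * (P.wt : ℤ) - P.p 0 - j = m - P.p 0 := by rw [h]; ring
  rw [e1, show (m : ℤ) - P.p 0 + P.p 0 = m by ring, if_pos (by omega), Int.toNat_natCast]
  unfold fq
  rw [pow_add, pow_add]
  ring

theorem lhs_eq {q : ℂ} (j : ℤ) (l : ℕ) :
    (∑' x : ℕ × Ptn,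
      (if (2 : ℤ) ∣ ((x.1 : ℤ) - j) ∧ 2 * (x.2.wt : ℤ) = j + (x.1 : ℤ) then
        q ^ (ch2 ((x.1 : ℤ) + 1) - (x.1 : ℤ) * (x.2.p 0 : ℤ) + 2 * (x.2.nConj : ℤ)
            + (x.2.wt : ℤ) - (x.2.headSum l : ℤ)) *
          ((qP q q x.1)⁻¹ * (Ptn.bConj q x.2)⁻¹)
      else 0)) = ∑' P, TP q l j P := by
  have hinj : Function.Injective (fun P : Ptn => (((2 * (P.wt : ℤ) - j).toNat, P) : ℕ × Ptn)) := by
    intro P Q h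
    exact (Prod.mk.inj h).2
  rw [← hinj.tsum_eq]
  · apply tsum_congr
    intro P
    simp only
    by_cases h : 0 ≤ 2 * (P.wt : ℤ) - j
    · rw [if_pos (by omega)]
      exact lhs_term j l P _ (by omega)
    · rw [if_neg (by omega)]
      unfold TP Aq
      rw [if_neg (by omega)]
      ring
  · rintro ⟨m, P⟩ hx
    by_contra hc
    apply hx
    simp only
    apply if_neg
    rintro ⟨-, h2⟩
    exact hc ⟨P, by simp only [Prod.mk.injEq, and_true]; omega⟩

end Helpers

/-- The key identity (3.24) of the paper. -/
theorem key_partition_identity (j : ℤ) (ℓ : ℕ) (q : ℂ) (hq : ‖q‖ < 1) :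
    (∑' x : ℕ × Ptn,
      (if (2 : ℤ) ∣ ((x.1 : ℤ) - j) ∧ 2 * (x.2.wt : ℤ) = j + (x.1 : ℤ) then
        q ^ (ch2 ((x.1 : ℤ) + 1) - (x.1 : ℤ) * (x.2.p 0 : ℤ) + 2 * (x.2.nConj : ℤ)
            + (x.2.wt : ℤ) - (x.2.headSum ℓ : ℤ)) *
          ((qP q q x.1)⁻¹ * (Ptn.bConj q x.2)⁻¹)
      else 0))
    = (qPInf q q)⁻¹ *
        ∑' i : ℕ,
          (q ^ (ch2 (j - 2 * (i : ℤ))) - q ^ (ch2 (j - 2 * (i : ℤ) - 2 * (ℓ : ℤ) - 1))) *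
            (qP q q i)⁻¹ := by
  rw [lhs_eq, TP_tsum hq, rhs_eq hq]
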